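/- Let Ω ⊆ ℝ^d be a compact C²-domain with boundary Γ = ∂Ω. Let ℓ ≥ 1 be a parameter, n a positive integer, and ε ∈ (0, ℓ). Suppose Λ ⊆ Ω is a finite set that is (ε/n)-separated with respect to the metric ρ_Ω (i.e. ρ_Ω(ω, ω′) ≥ ε/n for all distinct ω, ω′ ∈ Λ). Then for every 1 ≤ p ≤ ∞ and every f ∈ Π_n^d: ( Σ_{ξ∈Λ} |U(ξ, ε/n)| · (osc(f; U(ξ, ℓε/n)))^p )^{1/p} ≤ C_ℓ · ε · ‖f‖_{L^p(Ω)}, where C_ℓ > 0 depends only on ℓ and Ω; for p = ∞ the left-hand side is replaced by max_{ξ∈Λ} osc(f; U(ξ, ℓε/n)). -/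

import Mathlib

open MeasureTheory Set
open scoped ENNReal

noncomputable section

/-- `Ω ⊆ ℝ^d` is a compact `C²`-domain, with `ν` the unit outer normal field on `∂Ω`. -/
def IsCompactC2Domain {d : ℕ} (Ω : Set (EuclideanSpace ℝ (Fin d)))
    (ν : EuclideanSpace ℝ (Fin d) → EuclideanSpace ℝ (Fin d)) : Prop :=
  IsCompact Ω ∧
  ∃ κ₀ : ℝ, 0 < κ₀ ∧
    ∃ (J : ℕ) (U : Fin J → Set (EuclideanSpace ℝ (Fin d))),
      (∀ j, IsOpen (U j)) ∧
      frontier Ω ⊆ ⋃ j, U j ∧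
      (∀ j, ∃ Φ : EuclideanSpace ℝ (Fin d) → ℝ,
        ContDiff ℝ 2 Φ ∧
        U j ∩ frontier Ω = {ξ | ξ ∈ U j ∧ Φ ξ = 0} ∧
        ∀ ξ ∈ U j ∩ frontier Ω,
          gradient Φ ξ ≠ 0 ∧ ν ξ = ‖gradient Φ ξ‖⁻¹ • gradient Φ ξ) ∧
      ∀ ξ ∈ frontier Ω,
        ‖ν ξ‖ = 1 ∧
        Metric.ball (ξ - κ₀ • ν ξ) κ₀ ⊆ Ω ∧
        Metric.ball (ξ + κ₀ • ν ξ) κ₀ ⊆ Ωᶜ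

/-- The metric `ρ_Ω(ξ,η) = ‖ξ-η‖ + |√dist(ξ,∂Ω) − √dist(η,∂Ω)|`. -/
def rhoMetric {d : ℕ} (Ω : Set (EuclideanSpace ℝ (Fin d)))
    (ξ η : EuclideanSpace ℝ (Fin d)) : ℝ :=
  dist ξ η + |Real.sqrt (Metric.infDist ξ (frontier Ω)) -
    Real.sqrt (Metric.infDist η (frontier Ω))|

/-- The ball `U(ξ,t) = {η ∈ Ω : ρ_Ω(ξ,η) ≤ t}`. -/
def Uball {d : ℕ} (Ω : Set (EuclideanSpace ℝ (Fin d))) (ξ : EuclideanSpace ℝ (Fin d)) (t : ℝ) :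
    Set (EuclideanSpace ℝ (Fin d)) := {η ∈ Ω | rhoMetric Ω ξ η ≤ t}

/-- `f` is (the evaluation of) a real polynomial in `d` variables of total degree at most `n`. -/
def IsPolyDeg {d : ℕ} (n : ℕ) (f : EuclideanSpace ℝ (Fin d) → ℝ) : Prop :=
  ∃ P : MvPolynomial (Fin d) ℝ, P.totalDegree ≤ n ∧
    ∀ x : EuclideanSpace ℝ (Fin d), f x = MvPolynomial.eval (fun i => x i) P

/-- The oscillation `osc(f; I) = sup_{ξ,η ∈ I} |f(ξ) − f(η)|`. -/
def osc {d : ℕ} (f : EuclideanSpace ℝ (Fin d) → ℝ) (I : Set (EuclideanSpace ℝ (Fin d))) : ℝ :=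
  sSup {t : ℝ | ∃ ξ ∈ I, ∃ η ∈ I, t = |f ξ - f η|}

open Polynomial in
theorem two_pi_mul_coeff_eq_integral (P : ℂ[X]) (k : ℕ) :
    (2 * Real.pi : ℂ) * P.coeff k =
      ∫ θ in (0 : ℝ)..2 * Real.pi,
        P.eval (Complex.exp (θ * Complex.I)) * Complex.exp (-(k * θ * Complex.I)) := by
  have h1 : ∀ θ : ℝ, P.eval (Complex.exp (θ * Complex.I)) * Complex.exp (-(k * θ * Complex.I)) =
      ∑ j ∈ Finset.range (P.natDegree + 1),
        P.coeff j * Complex.exp ((((j : ℤ) - k : ℤ) * Complex.I) * θ) := by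
    intro θ
    rw [eval_eq_sum_range, Finset.sum_mul]
    refine Finset.sum_congr rfl fun j _ => ?_
    rw [← Complex.exp_nat_mul, mul_assoc, ← Complex.exp_add]
    congr 2
    push_cast
    ring
  have h2 : ∀ m : ℤ, ∫ θ in (0 : ℝ)..2 * Real.pi, Complex.exp ((m * Complex.I) * θ) =
      if m = 0 then (2 * Real.pi : ℂ) else 0 := by
    intro m
    split_ifs with hm
    · subst hm; simp
    · rw [integral_exp_mul_complex (mul_ne_zero (by exact_mod_cast hm) Complex.I_ne_zero)]
      have : Complex.exp (m * Complex.I * ((2 * Real.pi : ℝ) : ℂ)) = 1 := by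
        rw [Complex.exp_eq_one_iff]
        exact ⟨m, by push_cast; ring⟩
      rw [this]; simp
  simp_rw [h1]
  rw [intervalIntegral.integral_finsetSum
    (fun j _ => Continuous.intervalIntegrable (by fun_prop) _ _)]
  simp_rw [intervalIntegral.integral_const_mul, h2, sub_eq_zero]
  have h3 : ∀ j : ℕ, ((j : ℤ) = k) ↔ j = k := fun j => Nat.cast_inj
  simp_rw [h3]
  simp only [mul_ite, mul_zero, Finset.sum_ite_eq', Finset.mem_range]
  split_ifs with hk
  · ring
  · rw [coeff_eq_zero_of_natDegree_lt (by omega)]; simp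

open Polynomial in
theorem norm_coeff_le_integral (P : ℂ[X]) (k : ℕ) :
    ‖P.coeff k‖ ≤ ∫ θ in (0 : ℝ)..2 * Real.pi, ‖P.eval (Complex.exp (θ * Complex.I))‖ := by
  have h := congrArg norm (two_pi_mul_coeff_eq_integral P k)
  have hpi := Real.pi_gt_three
  have h1 : ‖(2 * Real.pi : ℂ) * P.coeff k‖ = 2 * Real.pi * ‖P.coeff k‖ := by
    rw [norm_mul]
    congr 1
    simp [abs_of_pos Real.pi_pos]
  rw [h1] at h
  have h2 := intervalIntegral.norm_integral_le_integral_norm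
    (f := fun θ : ℝ => P.eval (Complex.exp (θ * Complex.I)) * Complex.exp (-(k * θ * Complex.I)))
    (μ := volume) (show (0 : ℝ) ≤ 2 * Real.pi by positivity)
  have h3 : ∀ θ : ℝ, ‖P.eval (Complex.exp (θ * Complex.I)) *
      Complex.exp (-(k * θ * Complex.I))‖ = ‖P.eval (Complex.exp (θ * Complex.I))‖ := by
    intro θ
    rw [norm_mul]
    have : Complex.exp (-(k * θ * Complex.I)) = Complex.exp ((-(k * θ) : ℝ) * Complex.I) := by
      congr 1; push_cast; ring
    rw [this, Complex.norm_exp_ofReal_mul_I, mul_one]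
  simp_rw [h3] at h2
  nlinarith [norm_nonneg (P.coeff k)]

open Polynomial in
theorem norm_eval_le_integral_circle (P : ℂ[X]) {D : ℕ} (hD : P.natDegree ≤ D) {z : ℂ}
    (hz : 1 ≤ ‖z‖) :
    ‖P.eval z‖ ≤ (D + 1) * ‖z‖ ^ D *
      ∫ θ in (0 : ℝ)..2 * Real.pi, ‖P.eval (Complex.exp (θ * Complex.I))‖ := by
  rw [eval_eq_sum_range' (Nat.lt_succ_of_le hD)]
  refine (norm_sum_le _ _).trans ?_
  refine (Finset.sum_le_card_nsmul _ _ (‖z‖ ^ D *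
    ∫ θ in (0 : ℝ)..2 * Real.pi, ‖P.eval (Complex.exp (θ * Complex.I))‖) fun j hj => ?_).trans ?_
  · rw [norm_mul, norm_pow, mul_comm]
    have : j ≤ D := Nat.lt_succ_iff.mp (Finset.mem_range.mp hj)
    exact mul_le_mul (pow_le_pow_right₀ hz this) (norm_coeff_le_integral P j)
      (norm_nonneg _) (by positivity)
  · simp [nsmul_eq_mul, mul_assoc]

theorem integral_circle_eq_integral_unit (φ : ℝ → ℝ) (hφ : Continuous φ) :
    ∫ θ in (0 : ℝ)..2 * Real.pi, φ ((1 - Real.cos θ) / 2) * |Real.sin θ| =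
      4 * ∫ y in (0 : ℝ)..1, φ y := by
  have hd : ∀ θ : ℝ, HasDerivAt (fun θ => (1 - Real.cos θ) / 2) (Real.sin θ / 2) θ := by
    intro θ
    simpa using ((Real.hasDerivAt_cos θ).const_sub 1).div_const 2
  have key : ∀ a b : ℝ, ∫ θ in a..b, φ ((1 - Real.cos θ) / 2) * (Real.sin θ / 2) =
      ∫ y in ((1 - Real.cos a) / 2)..((1 - Real.cos b) / 2), φ y := by
    intro a b
    exact intervalIntegral.integral_comp_mul_deriv (fun x _ => hd x)
      (by fun_prop) hφ
  have hint : ∀ a b : ℝ, IntervalIntegrable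
      (fun θ => φ ((1 - Real.cos θ) / 2) * |Real.sin θ|) volume a b := by
    intro a b
    exact Continuous.intervalIntegrable (by fun_prop) _ _
  rw [← intervalIntegral.integral_add_adjacent_intervals (hint 0 Real.pi) (hint Real.pi _)]
  have h1 : ∫ θ in (0 : ℝ)..Real.pi, φ ((1 - Real.cos θ) / 2) * |Real.sin θ| =
      2 * ∫ y in (0 : ℝ)..1, φ y := by
    have := key 0 Real.pi
    norm_num at this
    rw [← this, ← intervalIntegral.integral_const_mul]
    refine intervalIntegral.integral_congr fun θ hθ => ?_
    rw [uIcc_of_le Real.pi_pos.le] at hθ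
    rw [abs_of_nonneg (Real.sin_nonneg_of_mem_Icc hθ)]
    ring
  have h2 : ∫ θ in Real.pi..2 * Real.pi, φ ((1 - Real.cos θ) / 2) * |Real.sin θ| =
      2 * ∫ y in (0 : ℝ)..1, φ y := by
    have := key Real.pi (2 * Real.pi)
    norm_num at this
    rw [intervalIntegral.integral_symm 0 1] at this
    rw [← neg_eq_iff_eq_neg.mpr this.symm.symm, ← intervalIntegral.integral_neg,
      ← intervalIntegral.integral_const_mul]
    refine intervalIntegral.integral_congr fun θ hθ => ?_
    rw [uIcc_of_le (by linarith [Real.pi_pos])] at hθ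
    have : Real.sin θ ≤ 0 := by
      rw [← Real.sin_sub_two_pi]
      exact Real.sin_nonpos_of_nonpos_of_neg_pi_le (by linarith [hθ.2]) (by linarith [hθ.1])
    rw [abs_of_nonpos this]
    ring
  rw [h1, h2]; ring

open Polynomial in
/-- The polynomial `ζ ^ N * g (-(ζ - 1) ^ 2 / (4 ζ))`, i.e. `g ∘ sin²(θ/2)` in the variable
`ζ = exp (iθ)`, cleared of denominators. -/
def circleLift (N : ℕ) (g : ℂ[X]) : ℂ[X] :=
  ∑ j ∈ Finset.range (N + 1), C (g.coeff j * (-1 / 4) ^ j) * (X - 1) ^ (2 * j) * X ^ (N - j)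

open Polynomial in
theorem natDegree_circleLift_le (N : ℕ) (g : ℂ[X]) : (circleLift N g).natDegree ≤ 2 * N := by
  refine natDegree_sum_le_of_forall_le _ _ fun j hj => ?_
  have hj' : j ≤ N := Nat.lt_succ_iff.mp (Finset.mem_range.mp hj)
  have h1 : ((X - 1 : ℂ[X]) ^ (2 * j)).natDegree ≤ 2 * j := by
    refine (natDegree_pow_le_of_le (m := 1) (2 * j) ?_).trans (by omega)
    have : (X - 1 : ℂ[X]) = X - C 1 := by simp
    rw [this, natDegree_X_sub_C]
  refine (natDegree_mul_le_of_le (natDegree_mul_le_of_le (natDegree_C _).le h1)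
    (natDegree_X_pow_le _)).trans (by omega)

open Polynomial in
theorem eval_circleLift {N : ℕ} {g : ℂ[X]} (hg : g.natDegree ≤ N) {ζ : ℂ} (hζ : ζ ≠ 0) :
    (circleLift N g).eval ζ = ζ ^ N * g.eval (-(ζ - 1) ^ 2 / (4 * ζ)) := by
  rw [circleLift, eval_finsetSum, eval_eq_sum_range' (Nat.lt_succ_of_le hg), Finset.mul_sum]
  refine Finset.sum_congr rfl fun j hj => ?_
  have hj' : j ≤ N := Nat.lt_succ_iff.mp (Finset.mem_range.mp hj)
  simp only [eval_mul, eval_C, eval_pow, eval_sub, eval_X, eval_one]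
  have h2 : ζ ^ N = ζ ^ (N - j) * ζ ^ j := by rw [← pow_add]; congr 1; omega
  have h3 : -(ζ - 1) ^ 2 / (4 * ζ) = (-1 / 4) * ((ζ - 1) ^ 2 / ζ) := by field_simp
  have h4 : ζ ^ j * ((ζ - 1) ^ 2 / ζ) ^ j = (ζ - 1) ^ (2 * j) := by
    rw [← mul_pow, mul_div_cancel₀ _ hζ, pow_mul]
  rw [h2, h3, mul_pow]
  linear_combination (-(g.coeff j * (-1 / 4) ^ j * ζ ^ (N - j))) * h4

open Polynomial in
/-- A polynomial equal to `1` at `z` and decaying on the unit circle away from `z`. -/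
def circleBump (N : ℕ) (z : ℂ) : ℂ[X] :=
  C (N : ℂ)⁻¹ * ∑ j ∈ Finset.range N, C (z⁻¹ ^ j) * X ^ j

open Polynomial in
theorem natDegree_circleBump_le (N : ℕ) (z : ℂ) : (circleBump N z).natDegree ≤ N := by
  refine (natDegree_C_mul_le _ _).trans (natDegree_sum_le_of_forall_le _ _ fun j hj => ?_)
  exact (natDegree_C_mul_X_pow_le _ _).trans (Finset.mem_range.mp hj).le

theorem eval_circleBump_self {N : ℕ} (hN : N ≠ 0) {z : ℂ} (hz : z ≠ 0) :
    (circleBump N z).eval z = 1 := by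
  simp only [circleBump, Polynomial.eval_mul, Polynomial.eval_C, Polynomial.eval_finsetSum,
    Polynomial.eval_pow, Polynomial.eval_X]
  have : ∀ j ∈ Finset.range N, z⁻¹ ^ j * z ^ j = 1 := by
    intro j _
    rw [← mul_pow, inv_mul_cancel₀ hz, one_pow]
  rw [Finset.sum_congr rfl this]
  simp [hN]

theorem norm_eval_circleBump_le {N : ℕ} (hN : N ≠ 0) {z ζ : ℂ} (hz : 1 ≤ ‖z‖) (hζ : ‖ζ‖ = 1) :
    ‖(circleBump N z).eval ζ‖ ≤ 1 ∧
      N * ‖ζ - z‖ * ‖(circleBump N z).eval ζ‖ ≤ 2 * ‖z‖ := by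
  have hz0 : z ≠ 0 := by rintro rfl; norm_num at hz
  have hN0 : (0 : ℝ) < N := by positivity
  have hq : ‖z⁻¹ * ζ‖ ≤ 1 := by
    rw [norm_mul, hζ, mul_one, norm_inv]; exact inv_le_one_of_one_le₀ hz
  have he : (circleBump N z).eval ζ = (N : ℂ)⁻¹ * ∑ j ∈ Finset.range N, (z⁻¹ * ζ) ^ j := by
    simp [circleBump, Polynomial.eval_finsetSum, mul_pow]
  have hnorm : ‖(circleBump N z).eval ζ‖ =
      (N : ℝ)⁻¹ * ‖∑ j ∈ Finset.range N, (z⁻¹ * ζ) ^ j‖ := by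
    rw [he, norm_mul, norm_inv, Complex.norm_natCast]
  constructor
  · rw [hnorm]
    have : ‖∑ j ∈ Finset.range N, (z⁻¹ * ζ) ^ j‖ ≤ N := by
      refine (norm_sum_le _ _).trans ?_
      refine (Finset.sum_le_card_nsmul _ _ 1 fun j _ => ?_).trans (by simp)
      rw [norm_pow]; exact pow_le_one₀ (norm_nonneg _) hq
    calc (N : ℝ)⁻¹ * _ ≤ (N : ℝ)⁻¹ * N := by gcongr
      _ = 1 := inv_mul_cancel₀ hN0.ne'
  · have h1 := geom_sum_mul (z⁻¹ * ζ) N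
    have h2 : ‖∑ j ∈ Finset.range N, (z⁻¹ * ζ) ^ j‖ * ‖z⁻¹ * ζ - 1‖ ≤ 2 := by
      rw [← norm_mul, h1]
      refine (norm_sub_le _ _).trans ?_
      rw [norm_pow, norm_one]
      linarith [pow_le_one₀ (n := N) (norm_nonneg _) hq]
    have h3 : ‖ζ - z‖ = ‖z‖ * ‖z⁻¹ * ζ - 1‖ := by
      rw [← norm_mul]; congr 1; field_simp
    rw [hnorm, h3]
    calc (N : ℝ) * (‖z‖ * ‖z⁻¹ * ζ - 1‖) *
          ((N : ℝ)⁻¹ * ‖∑ j ∈ Finset.range N, (z⁻¹ * ζ) ^ j‖)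
        = ‖z‖ * (‖∑ j ∈ Finset.range N, (z⁻¹ * ζ) ^ j‖ * ‖z⁻¹ * ζ - 1‖) := by
          field_simp
      _ ≤ ‖z‖ * 2 := by gcongr
      _ = 2 * ‖z‖ := mul_comm _ _

/-- Every `w` is of the form `-(z - 1)² / (4 z)` with `|z| ≥ 1`. -/
theorem exists_circle_param (w : ℂ) :
    ∃ z : ℂ, 1 ≤ ‖z‖ ∧ w = -(z - 1) ^ 2 / (4 * z) := by
  obtain ⟨r, hr⟩ := IsAlgClosed.exists_pow_nat_eq (4 * w ^ 2 - 4 * w) (n := 2) (by norm_num)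
  set z := 1 - 2 * w + r with hzdef
  have hz2 : z ^ 2 - (2 - 4 * w) * z + 1 = 0 := by
    rw [hzdef]; linear_combination hr
  have hz0 : z ≠ 0 := by rintro h; rw [h] at hz2; norm_num at hz2
  rcases le_total 1 ‖z‖ with h | h
  · refine ⟨z, h, ?_⟩
    field_simp
    linear_combination hz2
  · refine ⟨z⁻¹, ?_, ?_⟩
    · rw [norm_inv]; exact (one_le_inv₀ (norm_pos_iff.mpr hz0)).mpr h
    · field_simp
      linear_combination hz2

theorem norm_circle_param {z w : ℂ} (hz : 1 ≤ ‖z‖) (hw : w = -(z - 1) ^ 2 / (4 * z)) :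
    ‖z - 1‖ ^ 2 = 4 * ‖z‖ * ‖w‖ ∧ ‖z + 1‖ ^ 2 = 4 * ‖z‖ * ‖1 - w‖ ∧
      (‖z‖ - 1) ^ 2 = 2 * ‖z‖ * (‖w‖ + ‖1 - w‖ - 1) := by
  have hz0 : z ≠ 0 := by rintro rfl; norm_num at hz
  have hzn : 0 < ‖z‖ := by linarith
  have h1 : ‖z - 1‖ ^ 2 = 4 * ‖z‖ * ‖w‖ := by
    have : (z - 1) ^ 2 = -(4 * z * w) := by rw [hw]; field_simp
    rw [← norm_pow, this]; simp
  have h2 : ‖z + 1‖ ^ 2 = 4 * ‖z‖ * ‖1 - w‖ := by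
    have : (z + 1) ^ 2 = 4 * z * (1 - w) := by rw [hw]; field_simp; ring
    rw [← norm_pow, this]; simp
  refine ⟨h1, h2, ?_⟩
  have h3 := parallelogram_law_with_norm ℝ z 1
  rw [norm_one] at h3
  nlinarith

theorem one_add_mul_pow_le_exp {N : ℕ} (hN : N ≠ 0) (D : ℕ) :
    (1 + 4 / (N : ℝ)) ^ (2 * (D * N)) ≤ Real.exp (8 * D) := by
  have hN0 : (0 : ℝ) < N := by positivity
  calc (1 + 4 / (N : ℝ)) ^ (2 * (D * N)) ≤ (Real.exp (4 / N)) ^ (2 * (D * N)) := by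
        gcongr
        linarith [Real.add_one_le_exp (4 / (N : ℝ))]
    _ = Real.exp (8 * D) := by
        rw [← Real.exp_nat_mul]; congr 1; push_cast; field_simp; ring

set_option maxHeartbeats 1600000 in
/-- Weighted mean-value estimate for univariate polynomials on `[0,1]`, at complex points `w`
which are neither too close to the endpoints nor too far from the interval. -/
theorem exists_norm_eval_le_integral_unit (L : ℕ) : ∃ C : ℝ, 0 < C ∧ ∀ N : ℕ, 4 ≤ N →
    ∀ g : Polynomial ℂ, g.natDegree ≤ N → ∀ s : ℝ, 0 ≤ s → s ≤ 1 → ∀ w : ℂ,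
    ‖w‖ + ‖1 - w‖ ≤ 1 + 6 * (1 / (N : ℝ)) ^ 2 → ‖w‖ ≤ 1 →
    |√‖w‖ - s| ≤ 2 * (1 / (N : ℝ)) →
    (s + 1 / (N : ℝ)) ^ 2 / 16 ≤ ‖w‖ → 1 / 4 ≤ ‖1 - w‖ →
    ‖g.eval w‖ ≤ C * (N / (s + 1 / (N : ℝ))) *
      ∫ y in (0 : ℝ)..1, ‖g.eval (y : ℂ)‖ * ((1 + N * |√y - s|) ^ L)⁻¹ := by
  refine ⟨2 * ((L + 3 : ℕ) + 1) * Real.exp (8 * (L + 3 : ℕ)) * (2 * 11 ^ L * 4), by positivity, ?_⟩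
  intro N hN g hg s hs hs1 w hw1 hw2 hw3 hw4 hw5
  have hN0 : N ≠ 0 := by omega
  have hNR : (4 : ℝ) ≤ N := by exact_mod_cast hN
  set h : ℝ := 1 / (N : ℝ) with hh
  have hh0 : 0 < h := by positivity
  have hNh : (N : ℝ) * h = 1 := by rw [hh]; field_simp
  have hh4 : h ≤ 1 / 4 := by rw [hh]; gcongr
  obtain ⟨z, hz1, hwz⟩ := exists_circle_param w
  obtain ⟨hzm, hzp, hzz⟩ := norm_circle_param hz1 hwz
  have hz0 : z ≠ 0 := by rintro rfl; norm_num at hz1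
  -- size of `z`
  set q : ℝ := √‖z‖ with hq
  have hq2 : q ^ 2 = ‖z‖ := Real.sq_sqrt (by positivity)
  have hq1 : 1 ≤ q := by rw [hq]; exact Real.one_le_sqrt.mpr hz1
  have hqle : q ≤ 1 + 4 * h := by
    have h1 : (q ^ 2 - 1) ^ 2 ≤ (4 * h * q) ^ 2 := by
      rw [hq2, hzz]
      have : (4 * h * q) ^ 2 = 16 * h ^ 2 * ‖z‖ := by rw [← hq2]; ring
      rw [this]
      nlinarith only [mul_le_mul_of_nonneg_left hw1 (norm_nonneg z),
        mul_nonneg (sq_nonneg h) (norm_nonneg z)]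
    have h2 : q ^ 2 - 1 ≤ 4 * h * q := abs_le_of_sq_le_sq' h1 (by positivity) |>.2
    nlinarith only [h2, hq1, hh0]
  have hq22 : q ≤ 2 := by linarith
  have hz4 : ‖z‖ ≤ 4 := by rw [← hq2]; nlinarith only [hq1, hq22]
  set D : ℕ := (L + 3) * N with hD
  have hzD : ‖z‖ ^ D ≤ Real.exp (8 * (L + 3 : ℕ)) := by
    calc ‖z‖ ^ D = (q ^ 2) ^ D := by rw [hq2]
      _ = q ^ (2 * D) := by rw [← pow_mul]
      _ ≤ (1 + 4 * h) ^ (2 * D) := by gcongr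
      _ = (1 + 4 / (N : ℝ)) ^ (2 * ((L + 3) * N)) := by rw [hD, hh]; congr 2; ring
      _ ≤ _ := one_add_mul_pow_le_exp hN0 (L + 3)
  set a : ℝ := √‖w‖ with ha
  have ha2 : a ^ 2 = ‖w‖ := Real.sq_sqrt (norm_nonneg _)
  have ha0 : 0 ≤ a := Real.sqrt_nonneg _
  have ha1 : a ≤ 1 := by rw [ha]; exact Real.sqrt_le_one.mpr hw2
  have hzma : ‖z - 1‖ = 2 * q * a := by
    have : ‖z - 1‖ ^ 2 = (2 * q * a) ^ 2 := by rw [hzm, ← hq2, ← ha2]; ring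
    exact (pow_left_inj₀ (norm_nonneg _) (by positivity) two_ne_zero).mp this
  have hzms : |‖z - 1‖ - 2 * s| ≤ 12 * h := by
    rw [hzma]
    have : 2 * q * a - 2 * s = 2 * (q - 1) * a + 2 * (a - s) := by ring
    rw [this]
    have h3 := abs_le.mp hw3
    have hq0 : 0 ≤ q - 1 := by linarith
    have h4 : 2 * (q - 1) * a ≤ 8 * h :=
      (mul_le_of_le_one_right (by positivity) ha1).trans (by linarith)
    have h5 : 0 ≤ 2 * (q - 1) * a := by positivity
    exact abs_le.mpr ⟨by linarith [h3.1], by linarith [h3.2]⟩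
  have hden : (s + h) / 2 ≤ ‖z ^ 2 - 1‖ := by
    have h1 : ‖z ^ 2 - 1‖ = ‖z - 1‖ * ‖z + 1‖ := by rw [← norm_mul]; congr 1; ring
    have h2 : (s + h) / 2 ≤ ‖z - 1‖ := by
      refine (pow_le_pow_iff_left₀ (by positivity) (norm_nonneg _) two_ne_zero).mp ?_
      rw [hzm]
      have : ‖w‖ ≤ ‖z‖ * ‖w‖ := le_mul_of_one_le_left (norm_nonneg _) hz1
      linarith
    have h3 : 1 ≤ ‖z + 1‖ := by
      refine (pow_le_pow_iff_left₀ zero_le_one (norm_nonneg _) two_ne_zero).mp ?_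
      rw [hzp]
      have : ‖1 - w‖ ≤ ‖z‖ * ‖1 - w‖ := le_mul_of_one_le_left (norm_nonneg _) hz1
      linarith
    rw [h1]; exact h2.trans (le_mul_of_one_le_right (norm_nonneg _) h3)
  -- the auxiliary polynomial
  set P : Polynomial ℂ := circleLift N g * (Polynomial.X ^ 2 - 1) * circleBump N z ^ L with hP
  have hPdeg : P.natDegree ≤ D := by
    have h1 : (Polynomial.X ^ 2 - 1 : Polynomial ℂ).natDegree ≤ 2 := by
      have : (Polynomial.X ^ 2 - 1 : Polynomial ℂ) = Polynomial.X ^ 2 - Polynomial.C 1 := by simp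
      rw [this, Polynomial.natDegree_X_pow_sub_C]
    refine (Polynomial.natDegree_mul_le_of_le (Polynomial.natDegree_mul_le_of_le
      (natDegree_circleLift_le N g) h1) (Polynomial.natDegree_pow_le_of_le L
        (natDegree_circleBump_le N z))).trans ?_
    rw [hD]; nlinarith only [hN]
  have hPz : ‖g.eval w‖ * ((s + h) / 2) ≤ ‖P.eval z‖ := by
    have : P.eval z = z ^ N * g.eval w * (z ^ 2 - 1) := by
      rw [hP, Polynomial.eval_mul, Polynomial.eval_mul, Polynomial.eval_pow,
        eval_circleBump_self hN0 hz0, eval_circleLift hg hz0, ← hwz]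
      simp
    rw [this, norm_mul, norm_mul, norm_pow]
    have h1 : 1 ≤ ‖z‖ ^ N := one_le_pow₀ hz1
    have h2 : ‖g.eval w‖ ≤ ‖z‖ ^ N * ‖g.eval w‖ := le_mul_of_one_le_left (norm_nonneg _) h1
    gcongr
  have hcirc : ∀ θ : ℝ, ‖P.eval (Complex.exp (θ * Complex.I))‖ ≤
      2 * 11 ^ L * (‖g.eval (((1 - Real.cos θ) / 2 : ℝ) : ℂ)‖ *
        ((1 + N * |√((1 - Real.cos θ) / 2) - s|) ^ L)⁻¹ * |Real.sin θ|) := by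
    intro θ
    set ζ : ℂ := Complex.exp (θ * Complex.I) with hζ
    have hζ1 : ‖ζ‖ = 1 := Complex.norm_exp_ofReal_mul_I θ
    have hζ0 : ζ ≠ 0 := Complex.exp_ne_zero _
    have hζe : ζ = Complex.cos θ + Complex.sin θ * Complex.I := Complex.exp_mul_I θ
    set y : ℝ := (1 - Real.cos θ) / 2 with hy
    have hy0 : 0 ≤ y := by rw [hy]; linarith [Real.cos_le_one θ]
    have hcs := Complex.sin_sq_add_cos_sq (θ : ℂ)
    have hyz : ((y : ℝ) : ℂ) = -(ζ - 1) ^ 2 / (4 * ζ) := by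
      rw [eq_div_iff (by simp [hζ0]), hy, hζe]
      push_cast
      linear_combination (Complex.sin θ ^ 2) * Complex.I_sq - hcs
    have hsin : ‖ζ ^ 2 - 1‖ = 2 * |Real.sin θ| := by
      have : ζ ^ 2 - 1 = 2 * Complex.I * ζ * ((Real.sin θ : ℝ) : ℂ) := by
        rw [hζe]; push_cast
        linear_combination (-Complex.sin θ ^ 2) * Complex.I_sq + hcs
      rw [this, norm_mul, norm_mul, norm_mul, hζ1, Complex.norm_real, Real.norm_eq_abs]
      simp
    have hdist : ‖ζ - 1‖ = 2 * √y := by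
      have h1 : ‖ζ - 1‖ ^ 2 = 4 * y := by
        have : (ζ - 1) ^ 2 = -(4 * ζ * (y : ℂ)) := by rw [hyz]; field_simp
        rw [← norm_pow, this]
        simp [hζ1, abs_of_nonneg hy0]
      have : ‖ζ - 1‖ ^ 2 = (2 * √y) ^ 2 := by rw [h1, mul_pow, Real.sq_sqrt hy0]; norm_num
      exact (pow_left_inj₀ (norm_nonneg _) (by positivity) two_ne_zero).mp this
    obtain ⟨hT1, hT2⟩ := norm_eval_circleBump_le hN0 hz1 hζ1
    set T := ‖(circleBump N z).eval ζ‖ with hT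
    have hT0 : 0 ≤ T := norm_nonneg _
    have hsep : 2 * |√y - s| ≤ ‖ζ - z‖ + 12 * h := by
      have h1 : |‖ζ - 1‖ - ‖z - 1‖| ≤ ‖ζ - z‖ := by
        refine (abs_norm_sub_norm_le _ _).trans_eq ?_
        congr 1; ring
      rw [hdist] at h1
      have h2 : 2 * |√y - s| = |(2 * √y - ‖z - 1‖) + (‖z - 1‖ - 2 * s)| := by
        rw [← abs_two, ← abs_mul]
        congr 1
        rw [abs_two]; ring
      rw [h2]
      exact (abs_add_le _ _).trans (by linarith)
    have hTle : T ≤ 11 * (1 + N * |√y - s|)⁻¹ := by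
      rw [← div_eq_mul_inv, le_div_iff₀ (by positivity)]
      have h1 : N * |√y - s| ≤ N * ‖ζ - z‖ / 2 + 6 := by
        have := mul_le_mul_of_nonneg_left hsep (show (0 : ℝ) ≤ N by positivity)
        nlinarith only [this, hNh]
      have h2 := mul_le_mul_of_nonneg_left h1 hT0
      nlinarith only [h2, hT1, hT2, hT0, hz4]
    have hPe : P.eval ζ = ζ ^ N * g.eval ((y : ℝ) : ℂ) * (ζ ^ 2 - 1) *
        (circleBump N z).eval ζ ^ L := by
      rw [hP, Polynomial.eval_mul, Polynomial.eval_mul, Polynomial.eval_pow,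
        eval_circleLift hg hζ0, ← hyz]
      simp
    rw [hPe, norm_mul, norm_mul, norm_mul, norm_pow, hζ1, one_pow, one_mul, norm_pow, hsin]
    calc ‖g.eval (y : ℂ)‖ * (2 * |Real.sin θ|) * T ^ L
        ≤ ‖g.eval (y : ℂ)‖ * (2 * |Real.sin θ|) * (11 * (1 + N * |√y - s|)⁻¹) ^ L := by gcongr
      _ = _ := by rw [mul_pow, inv_pow]; ring
  obtain ⟨Ψ, hΨ⟩ : ∃ Ψ : ℝ → ℝ, Ψ = fun y : ℝ => ‖g.eval (y : ℂ)‖ * ((1 + N * |√y - s|) ^ L)⁻¹ :=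
    ⟨_, rfl⟩
  have hcont : Continuous Ψ := by
    rw [hΨ]
    refine Continuous.mul (by fun_prop) (Continuous.inv₀ (by fun_prop) fun y => ?_)
    positivity
  have hcircΨ : ∀ θ : ℝ, ‖P.eval (Complex.exp (θ * Complex.I))‖ ≤
      2 * 11 ^ L * (Ψ ((1 - Real.cos θ) / 2) * |Real.sin θ|) := by
    rw [hΨ]; exact hcirc
  have hint := intervalIntegral.integral_mono_on (μ := volume)
    (show (0 : ℝ) ≤ 2 * Real.pi by positivity)
    (Continuous.intervalIntegrable (by fun_prop) _ _)
    (Continuous.intervalIntegrable (by fun_prop) _ _)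
    (fun θ _ => hcircΨ θ)
  rw [intervalIntegral.integral_const_mul, integral_circle_eq_integral_unit _ hcont, hΨ] at hint
  set J := ∫ y in (0 : ℝ)..1, ‖g.eval (y : ℂ)‖ * ((1 + N * |√y - s|) ^ L)⁻¹ with hJ
  have hJ0 : 0 ≤ J := intervalIntegral.integral_nonneg zero_le_one fun y _ => by positivity
  have hfin := norm_eval_le_integral_circle P hPdeg hz1
  have h1 : ‖g.eval w‖ * ((s + h) / 2) ≤
      ((L + 3 : ℕ) + 1) * N * Real.exp (8 * (L + 3 : ℕ)) * (2 * 11 ^ L * (4 * J)) := by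
    refine hPz.trans (hfin.trans ?_)
    have hDle : ((D : ℝ) + 1) ≤ ((L + 3 : ℕ) + 1) * N := by rw [hD]; push_cast; nlinarith only [hNR]
    have hI0 : 0 ≤ ∫ θ in (0 : ℝ)..2 * Real.pi, ‖P.eval (Complex.exp (θ * Complex.I))‖ :=
      intervalIntegral.integral_nonneg (by positivity) fun y _ => by positivity
    gcongr
  have hsh : 0 < s + h := by positivity
  rw [← le_div_iff₀ (by positivity)] at h1
  refine h1.trans_eq ?_
  field_simp

theorem norm_add_norm_one_sub_le_of_dist_sq_eq {h s : ℝ} (hh0 : 0 < h) (hhs : h ≤ s)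
    (hs1 : s ^ 2 ≤ 1 / 2) {w : ℂ} (hw : ‖w - (s : ℂ) ^ 2‖ = h * s / 4) :
    ‖w‖ + ‖1 - w‖ ≤ 1 + 6 * h ^ 2 := by
  have hs0 : 0 < s := hh0.trans_le hhs
  have hss : h * s ≤ s ^ 2 := by nlinarith only [hs0, hhs]
  have hre : |w.re - s ^ 2| ≤ h * s / 4 := by
    have := Complex.abs_re_le_norm (w - (s : ℂ) ^ 2)
    rw [hw] at this
    have h1 : (w - (s : ℂ) ^ 2).re = w.re - s ^ 2 := by
      rw [← Complex.ofReal_pow, Complex.sub_re, Complex.ofReal_re]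
    rwa [h1] at this
  have him : |w.im| ≤ h * s / 4 := by
    have := Complex.abs_im_le_norm (w - (s : ℂ) ^ 2)
    rw [hw] at this
    have h1 : (w - (s : ℂ) ^ 2).im = w.im := by
      rw [← Complex.ofReal_pow, Complex.sub_im, Complex.ofReal_im, sub_zero]
    rwa [h1] at this
  have him2 : w.im ^ 2 ≤ (h * s / 4) ^ 2 := sq_le_sq' (abs_le.mp him).1 (abs_le.mp him).2
  have h2 := abs_le.mp hre
  have hu : 3 / 4 * s ^ 2 ≤ w.re := by linarith
  have hu' : w.re ≤ 5 / 8 := by linarith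
  have hh2 : 0 ≤ h ^ 2 := sq_nonneg h
  have hsq2 : 0 ≤ s ^ 2 := sq_nonneg s
  have hprod : 0 ≤ h ^ 2 * s ^ 2 := mul_nonneg hh2 hsq2
  have e1 : ‖w‖ ≤ w.re + h ^ 2 := by
    refine (pow_le_pow_iff_left₀ (norm_nonneg _) (by linarith) two_ne_zero).mp ?_
    rw [Complex.sq_norm, Complex.normSq_apply]
    nlinarith only [him2, mul_le_mul_of_nonneg_left hu hh2, sq_nonneg (h ^ 2), hprod]
  have e2 : ‖1 - w‖ ≤ 1 - w.re + h ^ 2 := by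
    refine (pow_le_pow_iff_left₀ (norm_nonneg _) (by linarith) two_ne_zero).mp ?_
    rw [Complex.sq_norm, Complex.normSq_apply]
    simp only [Complex.sub_re, Complex.sub_im, Complex.one_re, Complex.one_im]
    nlinarith only [him2, mul_le_mul_of_nonneg_left hu' hh2, sq_nonneg (h ^ 2),
      mul_le_mul_of_nonneg_left hs1 hh2]
  linarith

/-- Weighted mean-value estimate for univariate polynomials on `[0,1]`, on small discs. -/
theorem exists_norm_eval_le_integral_unit_of_dist (L : ℕ) : ∃ C : ℝ, 0 < C ∧ ∀ N : ℕ, 4 ≤ N →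
    ∀ g : Polynomial ℂ, g.natDegree ≤ N → ∀ s : ℝ, 0 ≤ s → s ^ 2 ≤ 1 / 2 → ∀ w : ℂ,
    ‖w - (s : ℂ) ^ 2‖ ≤ 1 / (N : ℝ) * (s + 1 / (N : ℝ)) / 8 →
    ‖g.eval w‖ ≤ C * (N / (s + 1 / (N : ℝ))) *
      ∫ y in (0 : ℝ)..1, ‖g.eval (y : ℂ)‖ * ((1 + N * |√y - s|) ^ L)⁻¹ := by
  obtain ⟨C, hC, hmain⟩ := exists_norm_eval_le_integral_unit L
  refine ⟨C, hC, ?_⟩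
  intro N hN g hg s hs hs2 w hw
  have hs1 : s ≤ 1 := by nlinarith only [hs2]
  specialize hmain N hN g hg s hs hs1
  have hNR : (4 : ℝ) ≤ N := by exact_mod_cast hN
  set h : ℝ := 1 / (N : ℝ) with hh
  have hh0 : 0 < h := by positivity
  have hh4 : h ≤ 1 / 4 := by rw [hh]; gcongr
  have hsn : ‖(s : ℂ) ^ 2‖ = s ^ 2 := by
    rw [norm_pow, Complex.norm_real, Real.norm_of_nonneg hs]
  have h1sn : ‖1 - (s : ℂ) ^ 2‖ = 1 - s ^ 2 := by
    rw [← Complex.ofReal_pow, ← Complex.ofReal_one, ← Complex.ofReal_sub, Complex.norm_real,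
      Real.norm_of_nonneg (by linarith)]
  obtain ⟨R, hR0, hRw, hR⟩ : ∃ R : ℝ, 0 < R ∧ h * (s + h) / 8 ≤ R ∧
      ∀ z : ℂ, ‖z - (s : ℂ) ^ 2‖ = R → ‖g.eval z‖ ≤ C * (N / (s + h)) *
      ∫ y in (0 : ℝ)..1, ‖g.eval (y : ℂ)‖ * ((1 + N * |√y - s|) ^ L)⁻¹ := by
    rcases le_or_gt h s with hhs | hhs
    · have hs0 : 0 < s := hh0.trans_le hhs
      refine ⟨h * s / 4, by positivity, by nlinarith only [hh0, hhs], fun z hz => ?_⟩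
      have hss : h * s ≤ s ^ 2 := by nlinarith only [hs0, hhs]
      have ha : |‖z‖ - s ^ 2| ≤ h * s / 4 := by
        rw [← hz, ← hsn]; exact abs_norm_sub_norm_le _ _
      have ha' := abs_le.mp ha
      have hb : ‖z‖ ≤ 5 / 8 := by linarith
      have hc : 1 - ‖z‖ ≤ ‖1 - z‖ := by simpa using norm_sub_norm_le (1 : ℂ) z
      refine hmain z (norm_add_norm_one_sub_le_of_dist_sq_eq hh0 hhs hs2 hz) (by linarith)
        ?_ ?_ (by linarith)
      · have h1 : |√‖z‖ - s| * s ≤ |‖z‖ - s ^ 2| := by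
          have : ‖z‖ - s ^ 2 = (√‖z‖ - s) * (√‖z‖ + s) := by
            nth_rw 1 [← Real.sq_sqrt (norm_nonneg z)]; ring
          rw [this, abs_mul, abs_of_nonneg (show 0 ≤ √‖z‖ + s by positivity)]
          gcongr
          linarith [Real.sqrt_nonneg ‖z‖]
        have h2 : |√‖z‖ - s| * s ≤ 2 * h * s := by nlinarith only [h1, ha, hh0, hs0]
        exact le_of_mul_le_mul_right h2 hs0
      · nlinarith only [ha'.1, hss, hhs, hh0]
    · refine ⟨2 * h ^ 2, by positivity, by nlinarith only [hhs, hh0], fun z hz => ?_⟩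
      have hsh : s ^ 2 ≤ h ^ 2 := by gcongr
      have hh2 : h ^ 2 ≤ 1 / 16 := by nlinarith only [hh0, hh4]
      have e1 : ‖z‖ ≤ s ^ 2 + 2 * h ^ 2 := by
        calc ‖z‖ = ‖(s : ℂ) ^ 2 + (z - (s : ℂ) ^ 2)‖ := by congr 1; ring
          _ ≤ _ := (norm_add_le _ _).trans_eq (by rw [hsn, hz])
      have e2 : ‖1 - z‖ ≤ 1 - s ^ 2 + 2 * h ^ 2 := by
        calc ‖1 - z‖ = ‖(1 - (s : ℂ) ^ 2) - (z - (s : ℂ) ^ 2)‖ := by congr 1; ring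
          _ ≤ _ := (norm_sub_le _ _).trans_eq (by rw [h1sn, hz])
      have e3 : h ^ 2 ≤ ‖z‖ := by
        have := norm_sub_le z ((s : ℂ) ^ 2)
        rw [hz, hsn] at this
        linarith
      have hc : 1 - ‖z‖ ≤ ‖1 - z‖ := by simpa using norm_sub_norm_le (1 : ℂ) z
      refine hmain z (by linarith) (by linarith) ?_ ?_ (by linarith)
      · have : √‖z‖ ≤ 2 * h := by
          rw [show 2 * h = √((2 * h) ^ 2) from (Real.sqrt_sq (by positivity)).symm]
          exact Real.sqrt_le_sqrt (by nlinarith only [e1, hsh, sq_nonneg h])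
        exact abs_le.mpr ⟨by linarith [Real.sqrt_nonneg ‖z‖], by linarith⟩
      · nlinarith only [e3, hhs, hs, hh0]
  have hcl : closure (Metric.ball ((s : ℂ) ^ 2) R) = Metric.closedBall ((s : ℂ) ^ 2) R :=
    closure_ball _ hR0.ne'
  refine Complex.norm_le_of_forall_mem_frontier_norm_le (U := Metric.ball ((s : ℂ) ^ 2) R)
    Metric.isBounded_ball (f := fun z => g.eval z) g.differentiable.diffContOnCl ?_ ?_
  · intro z hz
    rw [frontier_ball _ hR0.ne', mem_sphere_iff_norm] at hz
    exact hR z hz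
  · rw [hcl, mem_closedBall_iff_norm]
    exact hw.trans hRw

/-- The one-dimensional kernel. -/
def unitKernel (L N : ℕ) (s t : ℝ) : ℝ :=
  N / (s + 1 / (N : ℝ)) * ((1 + N * |√t - s|) ^ L)⁻¹

theorem exists_enorm_eval_le_lintegral_unit (L : ℕ) : ∃ C : ℝ, 0 < C ∧ ∀ N : ℕ, 4 ≤ N →
    ∀ g : Polynomial ℂ, g.natDegree ≤ N → ∀ s : ℝ, 0 ≤ s → s ^ 2 ≤ 1 / 2 → ∀ w : ℂ,
    ‖w - (s : ℂ) ^ 2‖ ≤ 1 / (N : ℝ) * (s + 1 / (N : ℝ)) / 8 →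
    ‖g.eval w‖ₑ ≤ ∫⁻ t in Icc (0 : ℝ) 1, ‖g.eval (t : ℂ)‖ₑ *
      ENNReal.ofReal (C * unitKernel L N s t) := by
  obtain ⟨C, hC, hmain⟩ := exists_norm_eval_le_integral_unit_of_dist L
  refine ⟨C, hC, ?_⟩
  intro N hN g hg s hs hs2 w hw
  have hN0 : (0 : ℝ) < N := by exact_mod_cast (by omega : 0 < N)
  have h1 := hmain N hN g hg s hs hs2 w hw
  rw [← intervalIntegral.integral_const_mul, intervalIntegral.integral_of_le zero_le_one,
    ← integral_Icc_eq_integral_Ioc] at h1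
  have hcont : Continuous fun t : ℝ => C * (N / (s + 1 / (N : ℝ))) *
      (‖g.eval (t : ℂ)‖ * ((1 + N * |√t - s|) ^ L)⁻¹) := by
    refine Continuous.mul (by fun_prop) (Continuous.mul (by fun_prop)
      (Continuous.inv₀ (by fun_prop) fun y => ?_))
    positivity
  rw [← ofReal_norm]
  refine (ENNReal.ofReal_le_ofReal h1).trans ?_
  rw [ofReal_integral_eq_lintegral_ofReal (hcont.integrableOn_Icc)
    (Filter.Eventually.of_forall fun t => by positivity)]
  refine (lintegral_congr fun t => ?_).le
  rw [← ofReal_norm, ← ENNReal.ofReal_mul (norm_nonneg _)]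
  congr 1
  rw [unitKernel]; ring

theorem enorm_le_lintegral_pi {ι : Type*} [Fintype ι] [DecidableEq ι] {G : (ι → ℂ) → ℂ}
    (hG : Continuous G)
    {k : ι → ℝ → ℝ≥0∞} (hk : ∀ i, Measurable (k i)) (μ : Measure ℝ) [SigmaFinite μ] {w : ι → ℂ}
    (h : ∀ i v, ‖G (Function.update v i (w i))‖ₑ ≤
      ∫⁻ t, ‖G (Function.update v i (t : ℂ))‖ₑ * k i t ∂μ) :
    ‖G w‖ₑ ≤ ∫⁻ u, ‖G (fun i => (u i : ℂ))‖ₑ * ∏ i, k i (u i) ∂(Measure.pi fun _ => μ) := by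
  set F : Finset ι → (ι → ℝ) → ℝ≥0∞ := fun S u =>
    ‖G (fun i => if i ∈ S then (u i : ℂ) else w i)‖ₑ * ∏ i ∈ S, k i (u i) with hF
  have hFm : ∀ S, Measurable (F S) := by
    intro S
    have h1 : Continuous fun u : ι → ℝ => G (fun i => if i ∈ S then (u i : ℂ) else w i) := by
      refine hG.comp (continuous_pi fun i => ?_)
      by_cases hi : i ∈ S <;> simp only [hi, if_true, if_false] <;> fun_prop
    refine Measurable.mul h1.enorm.measurable ?_
    exact Finset.measurable_fun_prod S fun i _ => (hk i).comp (measurable_pi_apply i)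
  have key : ∀ S : Finset ι, ∀ u, ‖G w‖ₑ ≤ lmarginal (fun _ => μ) S (F S) u := by
    intro S
    induction S using Finset.induction_on with
    | empty => intro u; simp [hF]
    | insert i S hi ih =>
      intro u
      refine (ih u).trans ?_
      rw [lmarginal_insert' _ (hFm _) hi]
      refine lmarginal_mono (fun u => ?_) u
      have h1 := h i (fun j => if j ∈ S then (u j : ℂ) else w j)
      have h2 : Function.update (fun j => if j ∈ S then (u j : ℂ) else w j) i (w i) =
          fun j => if j ∈ S then (u j : ℂ) else w j := by
        refine Function.update_eq_self_iff.mpr ?_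
        simp [hi]
      rw [h2] at h1
      have h3 : ∀ t : ℝ, F (insert i S) (Function.update u i t) =
          (∏ j ∈ S, k j (u j)) *
            (‖G (Function.update (fun j => if j ∈ S then (u j : ℂ) else w j) i (t : ℂ))‖ₑ
              * k i t) := by
        intro t
        simp only [hF]
        rw [Finset.prod_insert hi, Function.update_self]
        have e1 : ∏ j ∈ S, k j (Function.update u i t j) = ∏ j ∈ S, k j (u j) := by
          refine Finset.prod_congr rfl fun j hj => ?_
          rw [Function.update_of_ne]
          rintro rfl; exact hi hj
        have e2 : (fun j => if j ∈ insert i S then ((Function.update u i t j : ℝ) : ℂ) else w j) =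
            Function.update (fun j => if j ∈ S then (u j : ℂ) else w j) i (t : ℂ) := by
          funext j
          rcases eq_or_ne j i with rfl | hj
          · simp
          · simp [hj]
        rw [e1, e2]; ring
      simp only [h3]
      have hm : Measurable fun t : ℝ =>
          ‖G (Function.update (fun j => if j ∈ S then (u j : ℂ) else w j) i (t : ℂ))‖ₑ * k i t := by
        refine Measurable.mul ?_ (hk i)
        refine Continuous.measurable (Continuous.enorm (hG.comp ?_))
        exact Continuous.update continuous_const i Complex.continuous_ofReal
      rw [lintegral_const_mul _ hm]
      simp only [hF]
      rw [mul_comm]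
      gcongr
  have := key Finset.univ 0
  rw [lmarginal_univ] at this
  simpa [hF] using this

theorem measurePreserving_add_update {ι : Type*} [Fintype ι] [DecidableEq ι] (i₀ : ι)
    {q : (ι → ℝ) → ℝ} (hq : Measurable q) (hqi : ∀ x t, q (Function.update x i₀ t) = q x) :
    MeasurePreserving (fun x : ι → ℝ => Function.update x i₀ (x i₀ + q x)) volume volume := by
  have hm : Measurable (fun x : ι → ℝ => Function.update x i₀ (x i₀ + q x)) := by
    refine measurable_pi_iff.mpr fun i => ?_
    rcases eq_or_ne i i₀ with rfl | hi
    · simp only [Function.update_self]; fun_prop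
    · simp only [Function.update_of_ne hi]; fun_prop
  refine ⟨hm, Measure.ext_of_lintegral _ fun F hF => ?_⟩
  rw [lintegral_map hF hm]
  refine lintegral_eq_of_lmarginal_eq {i₀} (hF.comp hm) hF ?_
  rw [lmarginal_singleton, lmarginal_singleton]
  funext x
  simp only [Function.update_self, Function.update_idem, hqi]
  exact lintegral_add_right_eq_self (μ := volume) (fun t => F (Function.update x i₀ t)) (q x)

/-- Coordinates adapted to a paraboloid with vertex at the origin and axis in direction `i₀`. -/
def shear {d : ℕ} (i₀ : Fin d) (u : Fin d → ℝ) : Fin d → ℝ :=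
  fun i => if i = i₀ then u i₀ + ∑ j ∈ Finset.univ.erase i₀, (u j - 1 / 2) ^ 2 else u i - 1 / 2

theorem measurePreserving_shear {d : ℕ} (i₀ : Fin d) :
    MeasurePreserving (shear i₀) volume volume := by
  have h1 := measurePreserving_add_update i₀
    (q := fun x : Fin d → ℝ => ∑ j ∈ Finset.univ.erase i₀, x j ^ 2) (by fun_prop) (by
      intro x t
      refine Finset.sum_congr rfl fun j hj => ?_
      rw [Function.update_of_ne (Finset.ne_of_mem_erase hj)])
  have h2 := measurePreserving_add_right (volume : Measure (Fin d → ℝ))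
    (fun i => if i = i₀ then 0 else -(1 / 2))
  have h3 := h1.comp h2
  convert h3 using 1
  funext u i
  simp only [shear, Function.comp]
  rcases eq_or_ne i i₀ with rfl | hi
  · rw [Function.update_self]
    simp only [if_true, Pi.add_apply, add_zero, add_right_inj]
    refine Finset.sum_congr rfl fun j hj => ?_
    simp only [Finset.ne_of_mem_erase hj, if_false]; ring
  · rw [Function.update_of_ne hi]
    simp only [hi, if_false, Pi.add_apply]; ring

/-- A rotated, scaled and translated copy of the paraboloidal coordinates. -/
def frameMap {d : ℕ} (z₀ : EuclideanSpace ℝ (Fin d))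
    (b : OrthonormalBasis (Fin d) ℝ (EuclideanSpace ℝ (Fin d))) (i₀ : Fin d) (lam : ℝ)
    (u : Fin d → ℝ) : EuclideanSpace ℝ (Fin d) :=
  z₀ + lam • b.repr.symm (WithLp.toLp 2 (shear i₀ u))

theorem map_frameMap {d : ℕ} (z₀ : EuclideanSpace ℝ (Fin d))
    (b : OrthonormalBasis (Fin d) ℝ (EuclideanSpace ℝ (Fin d))) (i₀ : Fin d) {lam : ℝ}
    (hl : 0 < lam) :
    Measurable (frameMap z₀ b i₀ lam) ∧
    Measure.map (frameMap z₀ b i₀ lam) volume = ENNReal.ofReal ((lam ^ d)⁻¹) • volume := by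
  have h1 : MeasurePreserving (fun u => b.repr.symm (WithLp.toLp 2 (shear i₀ u)))
      volume volume :=
    (b.repr.symm.measurePreserving).comp
      ((PiLp.volume_preserving_toLp (Fin d)).comp (measurePreserving_shear i₀))
  have h2 : Measurable fun x : EuclideanSpace ℝ (Fin d) => lam • x := by fun_prop
  have h3 : Measurable fun x : EuclideanSpace ℝ (Fin d) => z₀ + x := by fun_prop
  refine ⟨h3.comp (h2.comp h1.measurable), ?_⟩
  have : frameMap z₀ b i₀ lam = (fun x => z₀ + x) ∘ (fun x => lam • x) ∘
    (fun u => b.repr.symm (WithLp.toLp 2 (shear i₀ u))) := rfl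
  rw [this, ← Measure.map_map h3 (h2.comp h1.measurable), ← Measure.map_map h2 h1.measurable,
    h1.map_eq, Measure.map_addHaar_smul _ hl.ne', Measure.map_smul,
    (measurePreserving_add_left volume z₀).map_eq, finrank_euclideanSpace_fin, abs_of_pos]
  positivity

theorem lintegral_comp_frameMap {d : ℕ} (z₀ : EuclideanSpace ℝ (Fin d))
    (b : OrthonormalBasis (Fin d) ℝ (EuclideanSpace ℝ (Fin d))) (i₀ : Fin d) {lam : ℝ}
    (hl : 0 < lam) {F : EuclideanSpace ℝ (Fin d) → ℝ≥0∞} (hF : Measurable F) :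
    ∫⁻ u, F (frameMap z₀ b i₀ lam u) = ENNReal.ofReal ((lam ^ d)⁻¹) * ∫⁻ x, F x := by
  obtain ⟨h1, h2⟩ := map_frameMap z₀ b i₀ hl
  rw [← lintegral_map hF h1, h2, lintegral_smul_measure, smul_eq_mul]

theorem volume_preimage_frameMap {d : ℕ} (z₀ : EuclideanSpace ℝ (Fin d))
    (b : OrthonormalBasis (Fin d) ℝ (EuclideanSpace ℝ (Fin d))) (i₀ : Fin d) {lam : ℝ}
    (hl : 0 < lam) {S : Set (EuclideanSpace ℝ (Fin d))} (hS : MeasurableSet S) :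
    volume S = ENNReal.ofReal (lam ^ d) * volume (frameMap z₀ b i₀ lam ⁻¹' S) := by
  obtain ⟨h1, h2⟩ := map_frameMap z₀ b i₀ hl
  rw [← Measure.map_apply h1 hS, h2, Measure.smul_apply, smul_eq_mul, ← mul_assoc,
    ← ENNReal.ofReal_mul (by positivity), mul_inv_cancel₀ (by positivity), ENNReal.ofReal_one,
    one_mul]

theorem frameMap_surjective {d : ℕ} (z₀ : EuclideanSpace ℝ (Fin d))
    (b : OrthonormalBasis (Fin d) ℝ (EuclideanSpace ℝ (Fin d))) (i₀ : Fin d) {lam : ℝ}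
    (hl : 0 < lam) : Function.Surjective (frameMap z₀ b i₀ lam) := by
  intro x
  set v : EuclideanSpace ℝ (Fin d) := b.repr (lam⁻¹ • (x - z₀)) with hv
  refine ⟨fun i => if i = i₀ then v i₀ - ∑ j ∈ Finset.univ.erase i₀, v j ^ 2 else v i + 1 / 2, ?_⟩
  have : WithLp.toLp 2 (shear i₀ (fun i => if i = i₀ then v i₀ -
      ∑ j ∈ Finset.univ.erase i₀, v j ^ 2 else v i + 1 / 2)) = v := by
    ext i
    simp only [shear]
    rcases eq_or_ne i i₀ with rfl | hi
    · simp only [if_true]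
      rw [sub_add_eq_add_sub, sub_eq_iff_eq_add, add_right_inj]
      refine Finset.sum_congr rfl fun j hj => ?_
      simp only [Finset.ne_of_mem_erase hj, if_false]; ring
    · simp only [hi, if_false]; ring
  rw [frameMap, this, hv, LinearIsometryEquiv.symm_apply_apply, smul_smul,
    mul_inv_cancel₀ hl.ne', one_smul, add_sub_cancel]

/-- Squared distance of the coordinates to the axis. -/
def axisDistSq {d : ℕ} (i₀ : Fin d) (u : Fin d → ℝ) : ℝ :=
  ∑ j ∈ Finset.univ.erase i₀, (u j - 1 / 2) ^ 2

/-- Square roots of the coordinates of the centre of a frame. -/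
def node {d : ℕ} (i₀ : Fin d) (s : ℝ) (i : Fin d) : ℝ := if i = i₀ then s else √(1 / 2)

/-- The centre of a frame. -/
def frameCenter {d : ℕ} (i₀ : Fin d) (s : ℝ) (i : Fin d) : ℝ := node i₀ s i ^ 2

section Frame

variable {d : ℕ} {z₀ : EuclideanSpace ℝ (Fin d)}
  {b : OrthonormalBasis (Fin d) ℝ (EuclideanSpace ℝ (Fin d))} {i₀ : Fin d} {lam s : ℝ}
  {u : Fin d → ℝ}

theorem axisDistSq_nonneg : 0 ≤ axisDistSq i₀ u := Finset.sum_nonneg fun _ _ => sq_nonneg _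

theorem node_nonneg (hs : 0 ≤ s) (i : Fin d) : 0 ≤ node i₀ s i := by
  unfold node; split_ifs <;> positivity

theorem center_self : frameCenter i₀ s i₀ = s ^ 2 := by simp [frameCenter, node]

theorem center_of_ne {i : Fin d} (hi : i ≠ i₀) : frameCenter i₀ s i = 1 / 2 := by
  simp [frameCenter, node, hi]

theorem center_le (hs2 : s ^ 2 ≤ 1 / 2) (i : Fin d) : frameCenter i₀ s i ≤ 1 / 2 := by
  rcases eq_or_ne i i₀ with rfl | hi
  · rwa [center_self]
  · rw [center_of_ne hi]

theorem node_le_one (hs2 : s ^ 2 ≤ 1 / 2) (i : Fin d) : node i₀ s i ≤ 1 := by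
  have := center_le (i₀ := i₀) hs2 i
  rw [frameCenter] at this
  nlinarith only [this]

theorem axisDistSq_center : axisDistSq i₀ (frameCenter i₀ s) = 0 :=
  Finset.sum_eq_zero fun j hj => by rw [center_of_ne (Finset.ne_of_mem_erase hj)]; ring

theorem norm_frameMap_sub_sq (c : ℝ) : ‖frameMap z₀ b i₀ lam u - (z₀ + c • b i₀)‖ ^ 2 =
    lam ^ 2 * axisDistSq i₀ u + (lam * (u i₀ + axisDistSq i₀ u) - c) ^ 2 := by
  have h1 : frameMap z₀ b i₀ lam u - (z₀ + c • b i₀) =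
      b.repr.symm (lam • WithLp.toLp 2 (shear i₀ u) - c • EuclideanSpace.single i₀ 1) := by
    rw [map_sub, map_smul, map_smul, OrthonormalBasis.repr_symm_single, frameMap]
    abel
  rw [h1, LinearIsometryEquiv.norm_map, EuclideanSpace.real_norm_sq_eq,
    ← Finset.add_sum_erase _ _ (Finset.mem_univ i₀), add_comm, axisDistSq, Finset.mul_sum]
  congr 1
  · refine Finset.sum_congr rfl fun j hj => ?_
    have := Finset.ne_of_mem_erase hj
    simp [shear, this]; ring
  · simp [shear]

theorem frameMap_center : frameMap z₀ b i₀ lam (frameCenter i₀ s) = z₀ + (lam * s ^ 2) • b i₀ := by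
  have := norm_frameMap_sub_sq (z₀ := z₀) (b := b) (i₀ := i₀) (lam := lam) (u := frameCenter i₀ s)
    (lam * s ^ 2)
  rw [axisDistSq_center, center_self] at this
  have h : ‖frameMap z₀ b i₀ lam (frameCenter i₀ s) - (z₀ + (lam * s ^ 2) • b i₀)‖ = 0 := by
    rw [← sq_eq_zero_iff, this]; ring
  exact sub_eq_zero.mp (norm_eq_zero.mp h)

theorem dist_center_frameMap_sq :
    dist (frameMap z₀ b i₀ lam (frameCenter i₀ s)) (frameMap z₀ b i₀ lam u) ^ 2 =
    lam ^ 2 * (axisDistSq i₀ u + (u i₀ + axisDistSq i₀ u - s ^ 2) ^ 2) := by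
  rw [dist_comm, frameMap_center, dist_eq_norm, norm_frameMap_sub_sq]; ring

theorem abs_sub_center_le (hs : 0 ≤ s) (hs2 : s ^ 2 ≤ 1 / 2)
    (hu : ∀ i, u i ∈ Icc (0 : ℝ) 1) (i : Fin d) :
    |u i - frameCenter i₀ s i| ≤ 2 * |√(u i) - node i₀ s i| := by
  have h1 : u i - frameCenter i₀ s i = (√(u i) + node i₀ s i) * (√(u i) - node i₀ s i) := by
    rw [frameCenter]; nth_rw 1 [← Real.sq_sqrt (hu i).1]; ring
  have h2 := node_nonneg (i₀ := i₀) hs i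
  rw [h1, abs_mul, abs_of_nonneg (by positivity)]
  have h3 : √(u i) ≤ 1 := Real.sqrt_le_one.mpr (hu i).2
  have h4 := node_le_one (i₀ := i₀) hs2 i
  gcongr
  linarith

theorem axisDistSq_le_sum (hu : ∀ i, u i ∈ Icc (0 : ℝ) 1) :
    axisDistSq i₀ u ≤ ∑ j ∈ Finset.univ.erase i₀, |u j - frameCenter i₀ s j| := by
  refine Finset.sum_le_sum fun j hj => ?_
  rw [center_of_ne (Finset.ne_of_mem_erase hj), ← sq_abs]
  have h1 : |u j - 1 / 2| ≤ 1 := abs_le.mpr ⟨by linarith [(hu j).1], by linarith [(hu j).2]⟩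
  nlinarith only [h1, abs_nonneg (u j - 1 / 2)]

theorem axisDistSq_le_sum_sq :
    axisDistSq i₀ u ≤ (∑ j ∈ Finset.univ.erase i₀, |u j - frameCenter i₀ s j|) ^ 2 := by
  refine le_trans (Finset.sum_le_sum fun j hj => ?_)
    (Finset.sum_sq_le_sq_sum_of_nonneg fun j _ => abs_nonneg _)
  rw [center_of_ne (Finset.ne_of_mem_erase hj), sq_abs]

theorem dist_frameMap_le (hl : 0 < lam) (hu : ∀ i, u i ∈ Icc (0 : ℝ) 1) :
    dist (frameMap z₀ b i₀ lam (frameCenter i₀ s)) (frameMap z₀ b i₀ lam u) ≤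
      lam * (2 * ∑ i, |u i - frameCenter i₀ s i|) := by
  have h0 := axisDistSq_nonneg (i₀ := i₀) (u := u)
  have h1 := axisDistSq_le_sum (i₀ := i₀) (s := s) hu
  have h2 := axisDistSq_le_sum_sq (i₀ := i₀) (s := s) (u := u)
  rw [← Finset.add_sum_erase _ _ (Finset.mem_univ i₀), center_self]
  set A := ∑ j ∈ Finset.univ.erase i₀, |u j - frameCenter i₀ s j|
  have hA : 0 ≤ A := Finset.sum_nonneg fun _ _ => abs_nonneg _
  refine (pow_le_pow_iff_left₀ dist_nonneg (by positivity) two_ne_zero).mp ?_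
  rw [dist_center_frameMap_sq, mul_pow]
  refine mul_le_mul_of_nonneg_left ?_ (sq_nonneg _)
  have h3 : |u i₀ + axisDistSq i₀ u - s ^ 2| ≤ |u i₀ - s ^ 2| + A := by
    have : u i₀ + axisDistSq i₀ u - s ^ 2 = (u i₀ - s ^ 2) + axisDistSq i₀ u := by ring
    rw [this]
    exact (abs_add_le _ _).trans (by rw [abs_of_nonneg h0]; linarith)
  have h4 : (u i₀ + axisDistSq i₀ u - s ^ 2) ^ 2 ≤ (|u i₀ - s ^ 2| + A) ^ 2 := by
    rw [← sq_abs]; gcongr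
  nlinarith only [h2, h4, mul_nonneg hA (abs_nonneg (u i₀ - s ^ 2)), sq_nonneg (u i₀ - s ^ 2),
    sq_abs (u i₀ - s ^ 2), sq_nonneg A]

theorem bounds_of_dist_frameMap_le (hl : 0 < lam) {r : ℝ}
    (hr : dist (frameMap z₀ b i₀ lam (frameCenter i₀ s)) (frameMap z₀ b i₀ lam u) ≤ r) :
    axisDistSq i₀ u ≤ (r / lam) ^ 2 ∧ |u i₀ + axisDistSq i₀ u - s ^ 2| ≤ r / lam ∧
      ∀ i, i ≠ i₀ → |u i - frameCenter i₀ s i| ≤ r / lam := by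
  have h0 := axisDistSq_nonneg (i₀ := i₀) (u := u)
  have hr0 : 0 ≤ r := dist_nonneg.trans hr
  have h1 := pow_le_pow_left₀ dist_nonneg hr 2
  rw [dist_center_frameMap_sq, mul_comm, ← le_div_iff₀ (by positivity), ← div_pow] at h1
  have hrl : 0 ≤ r / lam := by positivity
  have h2 : axisDistSq i₀ u ≤ (r / lam) ^ 2 := by
    linarith [sq_nonneg (u i₀ + axisDistSq i₀ u - s ^ 2)]
  refine ⟨h2, abs_le_of_sq_le_sq (by linarith) hrl, fun i hi => ?_⟩
  rw [center_of_ne hi]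
  refine abs_le_of_sq_le_sq (le_trans ?_ h2) hrl
  exact Finset.single_le_sum (f := fun j => (u j - 1 / 2) ^ 2) (fun _ _ => sq_nonneg _)
    (Finset.mem_erase.mpr ⟨hi, Finset.mem_univ _⟩)

end Frame

/-- Two-sided rolling ball condition for a compact set. -/
structure RollingBall {d : ℕ} (Ω : Set (EuclideanSpace ℝ (Fin d)))
    (ν : EuclideanSpace ℝ (Fin d) → EuclideanSpace ℝ (Fin d)) (κ : ℝ) : Prop where
  isCompact : IsCompact Ω
  pos : 0 < κ
  norm_eq : ∀ z ∈ frontier Ω, ‖ν z‖ = 1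
  inner_subset : ∀ z ∈ frontier Ω, Metric.ball (z - κ • ν z) κ ⊆ Ω
  outer_subset : ∀ z ∈ frontier Ω, Metric.ball (z + κ • ν z) κ ⊆ Ωᶜ

theorem IsCompactC2Domain.exists_rollingBall {d : ℕ} {Ω : Set (EuclideanSpace ℝ (Fin d))}
    {ν : EuclideanSpace ℝ (Fin d) → EuclideanSpace ℝ (Fin d)} (h : IsCompactC2Domain Ω ν) :
    ∃ κ, RollingBall Ω ν κ := by
  obtain ⟨h1, κ, h2, -, -, -, -, -, h3⟩ := h
  exact ⟨κ, h1, h2, fun z hz => (h3 z hz).1, fun z hz => (h3 z hz).2.1, fun z hz => (h3 z hz).2.2⟩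

/-- Distance to the boundary. -/
def bdDist {d : ℕ} (Ω : Set (EuclideanSpace ℝ (Fin d))) (x : EuclideanSpace ℝ (Fin d)) : ℝ :=
  Metric.infDist x (frontier Ω)

theorem bdDist_nonneg {d : ℕ} {Ω : Set (EuclideanSpace ℝ (Fin d))}
    {x : EuclideanSpace ℝ (Fin d)} : 0 ≤ bdDist Ω x := Metric.infDist_nonneg

theorem abs_bdDist_sub_le {d : ℕ} {Ω : Set (EuclideanSpace ℝ (Fin d))}
    {x y : EuclideanSpace ℝ (Fin d)} : |bdDist Ω x - bdDist Ω y| ≤ dist x y := by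
  have := (Metric.lipschitz_infDist_pt (frontier Ω)).dist_le_mul x y
  simpa [Real.dist_eq, bdDist] using this

theorem rhoMetric_eq {d : ℕ} {Ω : Set (EuclideanSpace ℝ (Fin d))}
    {x y : EuclideanSpace ℝ (Fin d)} :
    rhoMetric Ω x y = dist x y + |√(bdDist Ω x) - √(bdDist Ω y)| := rfl

theorem rhoMetric_nonneg {d : ℕ} {Ω : Set (EuclideanSpace ℝ (Fin d))}
    {x y : EuclideanSpace ℝ (Fin d)} : 0 ≤ rhoMetric Ω x y := by
  rw [rhoMetric_eq]; positivity

theorem rhoMetric_comm {d : ℕ} {Ω : Set (EuclideanSpace ℝ (Fin d))}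
    {x y : EuclideanSpace ℝ (Fin d)} : rhoMetric Ω x y = rhoMetric Ω y x := by
  rw [rhoMetric_eq, rhoMetric_eq, dist_comm, abs_sub_comm]

theorem rhoMetric_triangle {d : ℕ} {Ω : Set (EuclideanSpace ℝ (Fin d))}
    {x y z : EuclideanSpace ℝ (Fin d)} :
    rhoMetric Ω x z ≤ rhoMetric Ω x y + rhoMetric Ω y z := by
  rw [rhoMetric_eq, rhoMetric_eq, rhoMetric_eq]
  have h1 := dist_triangle x y z
  have h2 := abs_sub_le (√(bdDist Ω x)) (√(bdDist Ω y)) (√(bdDist Ω z))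
  linarith

theorem sqrt_bdDist_le {d : ℕ} {Ω : Set (EuclideanSpace ℝ (Fin d))}
    {x y : EuclideanSpace ℝ (Fin d)} : √(bdDist Ω y) ≤ √(bdDist Ω x) + rhoMetric Ω x y := by
  rw [rhoMetric_eq]
  have := (abs_le.mp (le_refl |√(bdDist Ω x) - √(bdDist Ω y)|)).1
  linarith [dist_nonneg (x := x) (y := y)]

theorem measurable_rhoMetric {d : ℕ} (Ω : Set (EuclideanSpace ℝ (Fin d)))
    (x : EuclideanSpace ℝ (Fin d)) : Continuous (rhoMetric Ω x) := by
  unfold rhoMetric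
  have := Metric.continuous_infDist_pt (frontier Ω)
  fun_prop

theorem mem_of_dist_lt_bdDist {d : ℕ} {Ω : Set (EuclideanSpace ℝ (Fin d))}
    {x y : EuclideanSpace ℝ (Fin d)} (hx : x ∈ Ω) (hy : dist y x < bdDist Ω x) : y ∈ Ω := by
  by_contra hyn
  have hfr : ∀ z ∈ Metric.ball x (bdDist Ω x), z ∉ frontier Ω := by
    intro z hz hzf
    rw [Metric.mem_ball, dist_comm] at hz
    exact absurd hz (not_lt.mpr (Metric.infDist_le_dist_of_mem hzf))
  have hxb := Metric.mem_ball_self (x := x) (dist_nonneg.trans_lt hy)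
  obtain ⟨z, -, hz1, hz2⟩ := (convex_ball x (bdDist Ω x)).isPreconnected (interior Ω) (closure Ω)ᶜ
    isOpen_interior isClosed_closure.isOpen_compl
    (fun z hz => or_iff_not_imp_right.mpr fun h =>
      by_contra fun h' => hfr z hz ⟨not_not.mp h, h'⟩)
    ⟨x, hxb, by_contra fun h' => hfr x hxb ⟨subset_closure hx, h'⟩⟩
    ⟨y, hy, fun h' => hfr y hy ⟨h', fun h => hyn (interior_subset h)⟩⟩
  exact hz2 (interior_subset_closure hz1)

theorem frontier_nonempty_of_isCompact {d : ℕ} (hd : 0 < d)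
    {Ω : Set (EuclideanSpace ℝ (Fin d))} (hΩ : IsCompact Ω) (hne : Ω.Nonempty) :
    (frontier Ω).Nonempty := by
  have : Nonempty (Fin d) := ⟨⟨0, hd⟩⟩
  have : NoncompactSpace (EuclideanSpace ℝ (Fin d)) := NormedSpace.noncompactSpace ℝ _
  exact nonempty_frontier_iff.mpr ⟨hne, hΩ.ne_univ⟩

namespace RollingBall

variable {d : ℕ} {Ω : Set (EuclideanSpace ℝ (Fin d))}
    {ν : EuclideanSpace ℝ (Fin d) → EuclideanSpace ℝ (Fin d)} {κ : ℝ}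
    {x z : EuclideanSpace ℝ (Fin d)}

theorem bdDist_add_le (h : RollingBall Ω ν κ) (hx : x ∈ Ω) (hz : z ∈ frontier Ω) :
    bdDist Ω x + κ ≤ dist x (z + κ • ν z) := by
  have ho := h.outer_subset z hz
  rcases (bdDist_nonneg (Ω := Ω) (x := x)).eq_or_lt with h0 | h0
  · rw [← h0, zero_add]
    by_contra hlt
    exact ho (Metric.mem_ball.mpr (not_le.mp hlt)) hx
  · refine (disjoint_ball_ball_iff h0 h.pos).mp ?_
    refine Set.disjoint_left.mpr fun y hy hy' => ho hy' ?_
    exact mem_of_dist_lt_bdDist hx hy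

theorem sub_dist_le_bdDist (h : RollingBall Ω ν κ) (hz : z ∈ frontier Ω) :
    κ - dist x (z - κ • ν z) ≤ bdDist Ω x := by
  refine (Metric.le_infDist ⟨z, hz⟩).mpr fun y hy => ?_
  have h1 : Metric.ball (z - κ • ν z) κ ⊆ interior Ω :=
    interior_maximal (h.inner_subset z hz) Metric.isOpen_ball
  have h2 : κ ≤ dist y (z - κ • ν z) := by
    by_contra hlt
    exact hy.2 (h1 (Metric.mem_ball.mpr (not_le.mp hlt)))
  have h3 := dist_triangle y x (z - κ • ν z)
  rw [dist_comm y x] at h3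
  linarith

theorem mem_of_dist_le (h : RollingBall Ω ν κ) (hz : z ∈ frontier Ω)
    (hx : dist x (z - κ • ν z) ≤ κ) : x ∈ Ω := by
  have h1 : closure (Metric.ball (z - κ • ν z) κ) ⊆ Ω :=
    h.isCompact.isClosed.closure_subset_iff.mpr (h.inner_subset z hz)
  rw [closure_ball _ h.pos.ne'] at h1
  exact h1 hx

theorem eq_sub_of_dist_eq (h : RollingBall Ω ν κ) (hx : x ∈ Ω) (hz : z ∈ frontier Ω)
    (hd : dist x z = bdDist Ω x) : x = z - bdDist Ω x • ν z := by
  have h1 := h.bdDist_add_le hx hz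
  set δ := bdDist Ω x with hδ
  have hδ0 : 0 ≤ δ := bdDist_nonneg
  have hκ := h.pos
  have h2 := pow_le_pow_left₀ (by positivity) h1 2
  rw [dist_eq_norm, show x - (z + κ • ν z) = (x - z) - κ • ν z by abel,
    norm_sub_sq_real, ← dist_eq_norm, hd, norm_smul, h.norm_eq z hz, inner_smul_right,
    Real.norm_of_nonneg hκ.le] at h2
  have h3 : inner ℝ (x - z) (ν z) ≤ -δ := by
    have : κ * inner ℝ (x - z) (ν z) ≤ κ * (-δ) := by linarith
    exact le_of_mul_le_mul_left this hκ
  have h4 : ‖(x - z) + δ • ν z‖ ^ 2 ≤ 0 := by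
    rw [norm_add_sq_real, ← dist_eq_norm, hd, norm_smul, h.norm_eq z hz, inner_smul_right,
      Real.norm_of_nonneg hδ0]
    nlinarith only [h3, hδ0]
  have h5 : (x - z) + δ • ν z = 0 := by
    rw [← norm_eq_zero, ← sq_eq_zero_iff]
    exact le_antisymm h4 (sq_nonneg _)
  rw [eq_sub_iff_add_eq, ← sub_eq_zero, ← h5]; abel

/-- Distance to the boundary in paraboloidal coordinates at a boundary point. -/
theorem bdDist_frameMap (h : RollingBall Ω ν κ) (hz : z ∈ frontier Ω)
    {b : OrthonormalBasis (Fin d) ℝ (EuclideanSpace ℝ (Fin d))} {i₀ : Fin d}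
    (hb : b i₀ = -ν z) {lam : ℝ} (hl : 0 < lam) (hlκ : lam ≤ κ) {u : Fin d → ℝ}
    (hq : |lam * (u i₀ + axisDistSq i₀ u)| ≤ κ / 2) (hx : frameMap z b i₀ lam u ∈ Ω) :
    lam * u i₀ ≤ bdDist Ω (frameMap z b i₀ lam u) ∧
    bdDist Ω (frameMap z b i₀ lam u) ≤ lam * (u i₀ + 2 * axisDistSq i₀ u) := by
  have hκ := h.pos
  have hT := axisDistSq_nonneg (i₀ := i₀) (u := u)
  set x := frameMap z b i₀ lam u with hxdef
  have h1 := norm_frameMap_sub_sq (z₀ := z) (b := b) (i₀ := i₀) (lam := lam) (u := u) κ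
  have h2 := norm_frameMap_sub_sq (z₀ := z) (b := b) (i₀ := i₀) (lam := lam) (u := u) (-κ)
  rw [← hxdef, ← dist_eq_norm, hb] at h1 h2
  have e1 : z + κ • -ν z = z - κ • ν z := by rw [smul_neg]; abel
  have e2 : z + (-κ) • -ν z = z + κ • ν z := by rw [smul_neg, neg_smul, neg_neg]
  rw [e1] at h1
  rw [e2] at h2
  have h3 := h.sub_dist_le_bdDist (x := x) hz
  have h4 := h.bdDist_add_le hx hz
  set T := axisDistSq i₀ u
  have hq' := abs_le.mp hq
  have hlT : 0 ≤ lam * T := by positivity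
  have hkT : lam * T * lam ≤ lam * T * κ := by gcongr
  constructor
  · have : dist x (z - κ • ν z) ≤ κ - lam * u i₀ := by
      refine (pow_le_pow_iff_left₀ dist_nonneg (by nlinarith only [hq', hlT, hκ])
        two_ne_zero).mp ?_
      rw [h1]
      have h5 : lam * T * κ ≤ lam * T * (2 * (κ - lam * (u i₀ + T)) ) := by
        gcongr; linarith
      nlinarith only [h5, hkT, sq_nonneg (lam * T)]
    linarith
  · have : dist x (z + κ • ν z) ≤ κ + lam * (u i₀ + 2 * T) := by
      refine (pow_le_pow_iff_left₀ dist_nonneg (by nlinarith only [hq', hlT, hκ])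
        two_ne_zero).mp ?_
      rw [h2]
      have h5 : lam * T * κ ≤ lam * T * (2 * (κ + lam * (u i₀ + T))) := by
        gcongr; linarith
      nlinarith only [h5, hkT, sq_nonneg (lam * T)]
    linarith

end RollingBall

/-- `frameMap z₀ b i₀ lam` parametrizes a neighbourhood of `ξ` in `Ω` in such a way that
`rhoMetric` is comparable to the distance between square roots of coordinates. -/
structure IsFrame {d : ℕ} (Ω : Set (EuclideanSpace ℝ (Fin d))) (C : ℝ)
    (ξ z₀ : EuclideanSpace ℝ (Fin d))
    (b : OrthonormalBasis (Fin d) ℝ (EuclideanSpace ℝ (Fin d))) (i₀ : Fin d) (lam s : ℝ) :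
    Prop where
  s_nonneg : 0 ≤ s
  s_sq_le : s ^ 2 ≤ 1 / 2
  lam_pos : 0 < lam
  lam_le : lam ≤ C
  inv_lam_le : lam⁻¹ ≤ C
  map_center : frameMap z₀ b i₀ lam (frameCenter i₀ s) = ξ
  mem : ∀ u : Fin d → ℝ, (∀ i, u i ∈ Icc (0 : ℝ) 1) → frameMap z₀ b i₀ lam u ∈ Ω
  rho_le : ∀ u : Fin d → ℝ, (∀ i, u i ∈ Icc (0 : ℝ) 1) →
    rhoMetric Ω ξ (frameMap z₀ b i₀ lam u) ≤ C * ∑ i, |√(u i) - node i₀ s i|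
  s_le : s ≤ C * √(bdDist Ω ξ)
  le_s : √(bdDist Ω ξ) ≤ C * s
  near : ∀ (t : ℝ) (u : Fin d → ℝ), t ≤ C⁻¹ → frameMap z₀ b i₀ lam u ∈ Ω →
    rhoMetric Ω ξ (frameMap z₀ b i₀ lam u) ≤ t →
    ∀ i, |u i - frameCenter i₀ s i| ≤ C * t * (node i₀ s i + t)

theorem IsFrame.mono {d : ℕ} {Ω : Set (EuclideanSpace ℝ (Fin d))} {C C' : ℝ}
    {ξ z₀ : EuclideanSpace ℝ (Fin d)}
    {b : OrthonormalBasis (Fin d) ℝ (EuclideanSpace ℝ (Fin d))} {i₀ : Fin d} {lam s : ℝ}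
    (h : IsFrame Ω C ξ z₀ b i₀ lam s) (hC : C ≤ C') : IsFrame Ω C' ξ z₀ b i₀ lam s where
  s_nonneg := h.s_nonneg
  s_sq_le := h.s_sq_le
  lam_pos := h.lam_pos
  lam_le := h.lam_le.trans hC
  inv_lam_le := h.inv_lam_le.trans hC
  map_center := h.map_center
  mem := h.mem
  rho_le u hu := (h.rho_le u hu).trans (by gcongr)
  s_le := h.s_le.trans (by gcongr)
  le_s := h.le_s.trans (by have := h.s_nonneg; gcongr)
  near t u ht hu hr i := by
    have hC0 : 0 < C := h.lam_pos.trans_le h.lam_le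
    have ht0 : 0 ≤ t := rhoMetric_nonneg.trans hr
    have := node_nonneg (i₀ := i₀) h.s_nonneg i
    refine (h.near t u (ht.trans (by gcongr)) hu hr i).trans ?_
    gcongr

theorem half_le_node_of_ne {d : ℕ} {i₀ i : Fin d} {s : ℝ} (hi : i ≠ i₀) :
    1 / 2 ≤ node i₀ s i := by
  simp only [node, hi, if_false]
  exact Real.le_sqrt_of_sq_le (by norm_num)

theorem exists_orthonormalBasis_apply_eq {d : ℕ} (i₀ : Fin d) {v : EuclideanSpace ℝ (Fin d)}
    (hv : ‖v‖ = 1) :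
    ∃ b : OrthonormalBasis (Fin d) ℝ (EuclideanSpace ℝ (Fin d)), b i₀ = v := by
  obtain ⟨b, hb⟩ := Orthonormal.exists_orthonormalBasis_extension_of_card_eq (𝕜 := ℝ)
    (ι := Fin d) (E := EuclideanSpace ℝ (Fin d)) (by simp) (v := fun _ => v) (s := {i₀}) (by
      refine ⟨fun i => hv, fun i j hij => ?_⟩
      exact absurd (Subsingleton.elim i j) hij)
  exact ⟨b, hb i₀ rfl⟩

namespace RollingBall

variable {d : ℕ} {Ω : Set (EuclideanSpace ℝ (Fin d))}
    {ν : EuclideanSpace ℝ (Fin d) → EuclideanSpace ℝ (Fin d)} {κ : ℝ}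

theorem frameMap_mem (h : RollingBall Ω ν κ) {z : EuclideanSpace ℝ (Fin d)}
    (hz : z ∈ frontier Ω)
    {b : OrthonormalBasis (Fin d) ℝ (EuclideanSpace ℝ (Fin d))} {i₀ : Fin d}
    (hb : b i₀ = -ν z) {lam : ℝ} (hl : 0 < lam) (hlκ : lam ≤ κ / (2 + d)) {u : Fin d → ℝ}
    (hu : ∀ i, u i ∈ Icc (0 : ℝ) 1) :
    |lam * (u i₀ + axisDistSq i₀ u)| ≤ κ / 2 ∧ frameMap z b i₀ lam u ∈ Ω := by
  have hκ := h.pos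
  have hT := axisDistSq_nonneg (i₀ := i₀) (u := u)
  have hTd : axisDistSq i₀ u ≤ d / 4 := by
    have h1 : axisDistSq i₀ u ≤ ∑ j ∈ Finset.univ.erase i₀, (1 / 4 : ℝ) :=
      Finset.sum_le_sum fun j _ => by nlinarith only [(hu j).1, (hu j).2]
    refine h1.trans ?_
    rw [Finset.sum_const, nsmul_eq_mul]
    have : ((Finset.univ.erase i₀).card : ℝ) ≤ d := by
      exact_mod_cast (Finset.card_le_univ _).trans_eq (Fintype.card_fin d)
    linarith
  have hd0 : (0 : ℝ) ≤ d := Nat.cast_nonneg d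
  have hlκ' : lam * (2 + d) ≤ κ := (le_div_iff₀ (by positivity)).mp hlκ
  have hu0 := (hu i₀).1
  have hu1 := (hu i₀).2
  have hq0 : 0 ≤ lam * (u i₀ + axisDistSq i₀ u) := by positivity
  have hq : lam * (u i₀ + axisDistSq i₀ u) ≤ κ / 2 := by
    have : lam * (u i₀ + axisDistSq i₀ u) ≤ lam * ((2 + d) / 2) := by gcongr; linarith
    linarith
  refine ⟨abs_le.mpr ⟨by linarith, hq⟩, h.mem_of_dist_le hz ?_⟩
  refine (pow_le_pow_iff_left₀ dist_nonneg hκ.le two_ne_zero).mp ?_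
  have e1 : z - κ • ν z = z + κ • b i₀ := by rw [hb, smul_neg]; abel
  rw [e1, dist_eq_norm, norm_frameMap_sub_sq]
  set T := axisDistSq i₀ u
  have hlk : lam ≤ κ := by nlinarith only [hlκ', hl, hd0]
  have hkT : lam * T * lam ≤ lam * T * κ := by gcongr
  have h5 : lam * (u i₀ + T) * (lam * (u i₀ + T)) ≤ lam * (u i₀ + T) * (κ / 2) := by gcongr
  have h6 : lam * T * κ ≤ lam * (u i₀ + T) * κ := by gcongr; linarith
  nlinarith only [h5, h6, hkT, mul_nonneg hq0 hκ.le]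

theorem exists_isFrame_of_bdDist_le (hd : 0 < d) (h : RollingBall Ω ν κ) :
    ∃ C, ∀ ξ ∈ Ω, bdDist Ω ξ ≤ κ / (2 + d) / 2 →
      ∃ z₀ b i₀ lam s, IsFrame Ω C ξ z₀ b i₀ lam s := by
  have hκ := h.pos
  set lam : ℝ := κ / (2 + d) with hlam
  have hl : 0 < lam := by positivity
  have hlκ : lam ≤ κ / 2 := by rw [hlam]; gcongr; linarith [(Nat.cast_nonneg d : (0 : ℝ) ≤ d)]
  set B : ℝ := √(2 * lam) with hB
  have hB0 : 0 < B := by positivity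
  set r : ℝ := √lam with hr
  have hr0 : 0 < r := by positivity
  have hrB : r ≤ B := Real.sqrt_le_sqrt (by linarith)
  have hr2 : r ^ 2 = lam := Real.sq_sqrt hl.le
  have hB2 : B ^ 2 = 2 * lam := Real.sq_sqrt (by positivity)
  set C : ℝ := 4 * lam + 2 * B + r⁻¹ + 4 / κ + 2 * lam⁻¹ + 2 * lam⁻¹ ^ 2 + 2 * r * lam⁻¹ with hC
  have hC0 : 0 < C := by positivity
  have hCle : ∀ {y : ℝ}, 0 ≤ C - y → y ≤ C := fun h => by linarith
  refine ⟨C, fun ξ hξ hδ => ?_⟩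
  have hfr := frontier_nonempty_of_isCompact hd h.isCompact ⟨ξ, hξ⟩
  obtain ⟨z, hz, hzd⟩ := isClosed_frontier.exists_infDist_eq_dist hfr ξ
  have hξz := h.eq_sub_of_dist_eq hξ hz hzd.symm
  obtain ⟨b, hb⟩ := exists_orthonormalBasis_apply_eq (⟨0, hd⟩ : Fin d) (v := -ν z)
    (by rw [norm_neg, h.norm_eq z hz])
  set i₀ : Fin d := ⟨0, hd⟩
  set δ := bdDist Ω ξ with hδdef
  have hδ0 : 0 ≤ δ := bdDist_nonneg
  set s : ℝ := √δ / r with hs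
  have hs0 : 0 ≤ s := by positivity
  have hsr : s * r = √δ := div_mul_cancel₀ _ hr0.ne'
  have hls : lam * s ^ 2 = δ := by
    rw [← hr2, ← mul_pow, mul_comm, hsr, Real.sq_sqrt hδ0]
  have hs2 : s ^ 2 ≤ 1 / 2 := by
    have : lam * s ^ 2 ≤ lam * (1 / 2) := by rw [hls]; linarith
    exact le_of_mul_le_mul_left this hl
  have hcenter : frameMap z b i₀ lam (frameCenter i₀ s) = ξ := by
    rw [frameMap_center, hls, hb, hξz, smul_neg]; abel
  refine ⟨z, b, i₀, lam, s, hs0, hs2, hl, hCle (by rw [hC]; ring_nf; positivity),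
    hCle (by rw [hC]; ring_nf; positivity), hcenter,
    fun u hu => (h.frameMap_mem hz hb hl le_rfl hu).2, fun u hu => ?_, ?_, ?_,
    fun t u ht hu hρ => ?_⟩
  · obtain ⟨hq, hmem⟩ := h.frameMap_mem hz hb hl le_rfl hu
    obtain ⟨h1, h2⟩ := h.bdDist_frameMap hz hb hl (by linarith) hq hmem
    have h3 := dist_frameMap_le (z₀ := z) (b := b) (i₀ := i₀) (s := s) hl hu
    rw [hcenter] at h3
    rw [rhoMetric_eq, ← hδdef, ← hsr]
    set x := frameMap z b i₀ lam u
    set S := ∑ i, |√(u i) - node i₀ s i| with hS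
    have h4 : ∑ i, |u i - frameCenter i₀ s i| ≤ 2 * S := by
      rw [hS, Finset.mul_sum]
      exact Finset.sum_le_sum fun i _ => abs_sub_center_le hs0 hs2 hu i
    have hSsplit : S = |√(u i₀) - s| + ∑ i ∈ Finset.univ.erase i₀, |√(u i) - node i₀ s i| := by
      rw [hS, ← Finset.add_sum_erase _ _ (Finset.mem_univ i₀)]; simp [node]
    set A := ∑ j ∈ Finset.univ.erase i₀, |u j - frameCenter i₀ s j| with hA
    have hA0 : 0 ≤ A := Finset.sum_nonneg fun _ _ => abs_nonneg _
    have h5 : A ≤ 2 * ∑ i ∈ Finset.univ.erase i₀, |√(u i) - node i₀ s i| := by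
      rw [Finset.mul_sum]
      exact Finset.sum_le_sum fun i _ => abs_sub_center_le hs0 hs2 hu i
    have h6 : axisDistSq i₀ u ≤ A ^ 2 := axisDistSq_le_sum_sq
    have e1 : √(lam * u i₀) = r * √(u i₀) := Real.sqrt_mul hl.le _
    have h7 : r * √(u i₀) ≤ √(bdDist Ω x) := by rw [← e1]; exact Real.sqrt_le_sqrt h1
    have h8 : √(bdDist Ω x) ≤ r * √(u i₀) + B * A := by
      refine (Real.sqrt_le_left (by positivity)).mpr (h2.trans ?_)
      have : (r * √(u i₀)) ^ 2 = lam * u i₀ := by rw [mul_pow, Real.sq_sqrt (hu i₀).1, hr2]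
      have h9 : B ^ 2 * axisDistSq i₀ u ≤ B ^ 2 * A ^ 2 := by gcongr
      rw [hB2] at h9
      have h10 : 0 ≤ r * √(u i₀) * (B * A) := by positivity
      nlinarith only [this, h9, h10, hB2]
    have h11 : |s * r - √(bdDist Ω x)| ≤ r * |√(u i₀) - s| + B * A := by
      have h12 : |√(u i₀) - s| * r = |√(u i₀) * r - s * r| := by
        rw [← sub_mul, abs_mul, abs_of_pos hr0]
      rw [mul_comm r, h12]
      have h13 := abs_le.mp (le_refl |√(u i₀) * r - s * r|)
      have h14 : 0 ≤ B * A := by positivity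
      exact abs_le.mpr ⟨by linarith [h13.2], by linarith [h13.1]⟩
    have hX : 0 ≤ |√(u i₀) - s| := abs_nonneg _
    have hS0 : 0 ≤ S := Finset.sum_nonneg fun _ _ => abs_nonneg _
    calc dist ξ x + |s * r - √(bdDist Ω x)|
        ≤ lam * (2 * (2 * S)) + (B * |√(u i₀) - s| +
            B * (2 * ∑ i ∈ Finset.univ.erase i₀, |√(u i) - node i₀ s i|)) := by
          refine add_le_add (h3.trans ?_) (h11.trans ?_) <;> gcongr
      _ ≤ (4 * lam + 2 * B) * S := by
          rw [hSsplit]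
          nlinarith only [mul_nonneg hB0.le hX]
      _ ≤ C * S := by
          gcongr
          exact hCle (by rw [hC]; ring_nf; positivity)
  · rw [hs, div_eq_inv_mul]
    gcongr
    exact hCle (by rw [hC]; ring_nf; positivity)
  · rw [← hsr, mul_comm]
    gcongr
    exact hCle (by rw [hC]; nlinarith only [show 0 < r⁻¹ + 4 / κ + 2 * lam⁻¹ + 2 * lam⁻¹ ^ 2 +
      2 * r * lam⁻¹ by positivity, hrB, hB0, hl])
  · have ht0 : 0 ≤ t := rhoMetric_nonneg.trans hρ
    have htκ : t ≤ κ / 4 := by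
      refine ht.trans (inv_le_of_inv_le₀ (by positivity) ?_)
      exact hCle (by rw [hC]; ring_nf; positivity)
    rw [rhoMetric_eq] at hρ
    set x := frameMap z b i₀ lam u with hx
    have hdist : dist (frameMap z b i₀ lam (frameCenter i₀ s)) (frameMap z b i₀ lam u) ≤ t := by
      rw [hcenter, ← hx]
      linarith [abs_nonneg (√(bdDist Ω ξ) - √(bdDist Ω x))]
    have hρ2 : |√δ - √(bdDist Ω x)| ≤ t := by linarith [dist_nonneg (x := ξ) (y := x)]
    obtain ⟨h1, h2, h3⟩ := bounds_of_dist_frameMap_le hl hdist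
    intro i
    have hn := node_nonneg (i₀ := i₀) hs0 i
    rcases eq_or_ne i i₀ with rfl | hi
    · have hq : |lam * (u i₀ + axisDistSq i₀ u)| ≤ κ / 2 := by
        have e : lam * (u i₀ + axisDistSq i₀ u) =
          lam * (u i₀ + axisDistSq i₀ u - s ^ 2) + lam * s ^ 2 := by ring
        rw [e]
        refine (abs_add_le _ _).trans ?_
        rw [abs_mul, abs_of_pos hl, hls, abs_of_nonneg hδ0]
        have : lam * |u i₀ + axisDistSq i₀ u - s ^ 2| ≤ lam * (t / lam) := by gcongr
        rw [mul_div_cancel₀ _ hl.ne'] at this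
        linarith
      obtain ⟨h4, h5⟩ := h.bdDist_frameMap hz hb hl (by linarith) hq hu
      rw [← hx] at h4 h5
      have hδx0 : 0 ≤ bdDist Ω x := bdDist_nonneg
      have h6 : |bdDist Ω x - δ| ≤ t * (2 * (s * r) + t) := by
        have e : bdDist Ω x - δ = (√(bdDist Ω x) - √δ) * (√(bdDist Ω x) + √δ) := by
          nth_rw 1 [← Real.sq_sqrt hδ0, ← Real.sq_sqrt hδx0]; ring
        rw [e, abs_mul, abs_sub_comm]
        have : √(bdDist Ω x) + √δ ≤ 2 * (s * r) + t := by
          rw [hsr]; linarith [(abs_le.mp hρ2).1]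
        rw [abs_of_nonneg (show 0 ≤ √(bdDist Ω x) + √δ by positivity)]
        gcongr
      have h7 : lam * (2 * axisDistSq i₀ u) ≤ 2 * t ^ 2 * lam⁻¹ := by
        calc lam * (2 * axisDistSq i₀ u) ≤ lam * (2 * (t / lam) ^ 2) := by gcongr
          _ = _ := by field_simp
      have h8 : |lam * (u i₀ - s ^ 2)| ≤ t * (2 * (s * r) + t) + 2 * t ^ 2 * lam⁻¹ := by
        have h6' := abs_le.mp h6
        have h9 : 0 ≤ 2 * t ^ 2 * lam⁻¹ := by positivity
        rw [mul_sub, hls]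
        exact abs_le.mpr ⟨by linarith, by linarith⟩
      rw [center_self]
      simp only [node, if_true]
      rw [abs_mul, abs_of_pos hl, mul_comm, ← le_div_iff₀ hl, div_eq_mul_inv] at h8
      refine h8.trans ?_
      have c1 : 2 * r * lam⁻¹ ≤ C := hCle (by rw [hC]; ring_nf; positivity)
      have c2 : lam⁻¹ + 2 * lam⁻¹ ^ 2 ≤ C := hCle (by rw [hC]; ring_nf; positivity)
      calc (t * (2 * (s * r) + t) + 2 * t ^ 2 * lam⁻¹) * lam⁻¹
          = (2 * r * lam⁻¹) * t * s + (lam⁻¹ + 2 * lam⁻¹ ^ 2) * t * t := by ring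
        _ ≤ C * t * s + C * t * t := by gcongr
        _ = _ := by ring
    · refine (h3 i hi).trans ?_
      have h4 := half_le_node_of_ne (s := s) hi
      have c1 : 2 * lam⁻¹ ≤ C := hCle (by rw [hC]; ring_nf; positivity)
      calc t / lam = 2 * lam⁻¹ * t * (1 / 2 + 0) := by rw [div_eq_mul_inv]; ring
        _ ≤ _ := by gcongr

end RollingBall

namespace RollingBall

variable {d : ℕ} {Ω : Set (EuclideanSpace ℝ (Fin d))}
    {ν : EuclideanSpace ℝ (Fin d) → EuclideanSpace ℝ (Fin d)} {κ : ℝ}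

theorem exists_bdDist_le (h : RollingBall Ω ν κ) :
    ∃ M : ℝ, 0 < M ∧ ∀ x ∈ Ω, bdDist Ω x ≤ M := by
  obtain ⟨M, hM⟩ := (h.isCompact.image_of_continuousOn
    (Metric.continuous_infDist_pt (frontier Ω)).continuousOn).bddAbove
  exact ⟨max M 1, by positivity, fun x hx => (hM ⟨x, hx, rfl⟩).trans (le_max_left _ _)⟩

theorem exists_isFrame_of_lt_bdDist (hd : 0 < d) (h : RollingBall Ω ν κ) {m : ℝ} (hm : 0 < m) :
    ∃ C, ∀ ξ ∈ Ω, m < bdDist Ω ξ → ∃ z₀ b i₀ lam s, IsFrame Ω C ξ z₀ b i₀ lam s := by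
  obtain ⟨M, hM, hMle⟩ := h.exists_bdDist_le
  have hd0 : (0 : ℝ) < d := by exact_mod_cast hd
  set lam : ℝ := m / (2 * d) with hlam
  have hl : 0 < lam := by positivity
  have hlm : lam * (2 * d) = m := div_mul_cancel₀ _ (by positivity)
  set r : ℝ := √m with hr
  have hr0 : 0 < r := Real.sqrt_pos.mpr hm
  set C : ℝ := 4 * lam * (1 + r⁻¹) + r⁻¹ + 2 * √M + 2 * lam⁻¹ + 2 * lam⁻¹ ^ 2 + lam + 1 with hC
  have hC0 : 0 < C := by positivity
  have hC1 : 1 ≤ C := by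
    have : 0 < 4 * lam * (1 + r⁻¹) + r⁻¹ + 2 * √M + 2 * lam⁻¹ + 2 * lam⁻¹ ^ 2 + lam := by
      positivity
    linarith
  have hCle : ∀ {y : ℝ}, 0 ≤ C - y → y ≤ C := fun h => by linarith
  refine ⟨C, fun ξ hξ hδ => ?_⟩
  set b := EuclideanSpace.basisFun (Fin d) ℝ
  set i₀ : Fin d := ⟨0, hd⟩
  set δ := bdDist Ω ξ with hδdef
  have hδ0 : 0 < δ := hm.trans hδ
  set s : ℝ := √(1 / 2) with hs
  have hs0 : 0 ≤ s := Real.sqrt_nonneg _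
  have hs2' : s ^ 2 = 1 / 2 := Real.sq_sqrt (by norm_num)
  have hs2 : s ^ 2 ≤ 1 / 2 := hs2'.le
  have hsh : 1 / 2 ≤ s := Real.le_sqrt_of_sq_le (by norm_num)
  have hs1 : s ≤ 1 := by nlinarith only [hs2]
  have hnode : ∀ i, node i₀ s i = s := fun i => by simp [node, hs]
  have hrδ : r ≤ √δ := Real.sqrt_le_sqrt hδ.le
  set z : EuclideanSpace ℝ (Fin d) := ξ - (lam * s ^ 2) • b i₀ with hz
  have hcenter : frameMap z b i₀ lam (frameCenter i₀ s) = ξ := by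
    rw [frameMap_center, hz, sub_add_cancel]
  have hdist : ∀ u : Fin d → ℝ, (∀ i, u i ∈ Icc (0 : ℝ) 1) →
      dist ξ (frameMap z b i₀ lam u) ≤ lam * (2 * ∑ i, |u i - frameCenter i₀ s i|) := by
    intro u hu
    have := dist_frameMap_le (z₀ := z) (b := b) (i₀ := i₀) (s := s) hl hu
    rwa [hcenter] at this
  refine ⟨z, b, i₀, lam, s, hs0, hs2, hl, hCle (by rw [hC]; ring_nf; positivity),
    hCle (by rw [hC]; ring_nf; positivity), hcenter, fun u hu => ?_, fun u hu => ?_, ?_, ?_,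
    fun t u ht hu hρ => ?_⟩
  · refine mem_of_dist_lt_bdDist hξ (lt_of_le_of_lt ?_ hδ)
    rw [dist_comm]
    refine (hdist u hu).trans ?_
    have : ∑ i, |u i - frameCenter i₀ s i| ≤ ∑ i : Fin d, (1 / 2 : ℝ) := by
      refine Finset.sum_le_sum fun i _ => ?_
      rw [frameCenter, hnode, hs2']
      exact abs_le.mpr ⟨by linarith [(hu i).1], by linarith [(hu i).2]⟩
    rw [Finset.sum_const, nsmul_eq_mul, Finset.card_univ, Fintype.card_fin] at this
    calc lam * (2 * ∑ i, |u i - frameCenter i₀ s i|) ≤ lam * (2 * (d * (1 / 2))) := by gcongr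
      _ ≤ _ := by rw [← hlm]; nlinarith only [mul_pos hl hd0]
  · set x := frameMap z b i₀ lam u
    set S := ∑ i, |√(u i) - node i₀ s i| with hS
    have hS0 : 0 ≤ S := Finset.sum_nonneg fun _ _ => abs_nonneg _
    have h4 : ∑ i, |u i - frameCenter i₀ s i| ≤ 2 * S := by
      rw [hS, Finset.mul_sum]
      exact Finset.sum_le_sum fun i _ => abs_sub_center_le hs0 hs2 hu i
    have h5 : dist ξ x ≤ 4 * lam * S := by
      refine (hdist u hu).trans ?_
      calc lam * (2 * ∑ i, |u i - frameCenter i₀ s i|) ≤ lam * (2 * (2 * S)) := by gcongr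
        _ = _ := by ring
    have h6 : |√δ - √(bdDist Ω x)| ≤ r⁻¹ * dist ξ x := by
      rw [inv_mul_eq_div, le_div_iff₀ hr0]
      have h7 : |√δ - √(bdDist Ω x)| * (√δ + √(bdDist Ω x)) = |δ - bdDist Ω x| := by
        have e : δ - bdDist Ω x = (√δ - √(bdDist Ω x)) * (√δ + √(bdDist Ω x)) := by
          nth_rw 1 [← Real.sq_sqrt hδ0.le, ← Real.sq_sqrt (bdDist_nonneg (Ω := Ω) (x := x))]; ring
        rw [e, abs_mul, abs_of_nonneg (show 0 ≤ √δ + √(bdDist Ω x) by positivity)]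
      refine le_trans ?_ (h7.le.trans abs_bdDist_sub_le)
      gcongr
      linarith [Real.sqrt_nonneg (bdDist Ω x)]
    rw [rhoMetric_eq, ← hδdef]
    calc dist ξ x + |√δ - √(bdDist Ω x)| ≤ 4 * lam * S + r⁻¹ * (4 * lam * S) := by
          refine add_le_add h5 (h6.trans ?_); gcongr
      _ = (4 * lam * (1 + r⁻¹)) * S := by ring
      _ ≤ C * S := by
        gcongr
        exact hCle (by rw [hC]; ring_nf; positivity)
  · have : r⁻¹ ≤ C := hCle (by rw [hC]; ring_nf; positivity)
    calc s ≤ r⁻¹ * r := by rw [inv_mul_cancel₀ hr0.ne']; exact hs1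
      _ ≤ C * √δ := by gcongr
  · have : 2 * √M ≤ C := hCle (by rw [hC]; ring_nf; positivity)
    calc √δ ≤ √M := Real.sqrt_le_sqrt (hMle ξ hξ)
      _ = 2 * √M * (1 / 2) := by ring
      _ ≤ C * s := by gcongr
  · have ht0 : 0 ≤ t := rhoMetric_nonneg.trans hρ
    have ht1 : t ≤ 1 := ht.trans (inv_le_one_of_one_le₀ hC1)
    rw [rhoMetric_eq] at hρ
    have hdist : dist (frameMap z b i₀ lam (frameCenter i₀ s)) (frameMap z b i₀ lam u) ≤ t := by
      rw [hcenter]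
      linarith [abs_nonneg (√(bdDist Ω ξ) - √(bdDist Ω (frameMap z b i₀ lam u)))]
    obtain ⟨h1, h2, h3⟩ := bounds_of_dist_frameMap_le hl hdist
    have hT := axisDistSq_nonneg (i₀ := i₀) (u := u)
    have c1 : 2 * lam⁻¹ + 2 * lam⁻¹ ^ 2 ≤ C := hCle (by rw [hC]; ring_nf; positivity)
    have hA : ∀ i, |u i - frameCenter i₀ s i| ≤ (lam⁻¹ + lam⁻¹ ^ 2) * t := by
      intro i
      have h5 : t / lam ≤ (lam⁻¹ + lam⁻¹ ^ 2) * t := by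
        rw [div_eq_mul_inv, mul_comm]
        gcongr
        linarith [sq_nonneg lam⁻¹]
      rcases eq_or_ne i i₀ with rfl | hi
      · rw [center_self]
        have h6 : (t / lam) ^ 2 ≤ lam⁻¹ ^ 2 * t := by
          rw [div_eq_mul_inv, mul_pow, mul_comm]
          gcongr
          nlinarith only [ht0, ht1]
        have h7 := abs_le.mp h2
        have h8 : t / lam = lam⁻¹ * t := by rw [div_eq_mul_inv, mul_comm]
        exact abs_le.mpr ⟨by linarith, by linarith⟩
      · exact (h3 i hi).trans h5
    intro i
    refine (hA i).trans ?_
    rw [hnode]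
    calc (lam⁻¹ + lam⁻¹ ^ 2) * t = (2 * lam⁻¹ + 2 * lam⁻¹ ^ 2) * t * (1 / 2 + 0) := by ring
      _ ≤ C * t * (s + t) := by gcongr

theorem exists_isFrame (hd : 0 < d) (h : RollingBall Ω ν κ) :
    ∃ C, 1 ≤ C ∧ ∀ ξ ∈ Ω, ∃ z₀ b i₀ lam s, IsFrame Ω C ξ z₀ b i₀ lam s := by
  have hκ := h.pos
  obtain ⟨C₁, h₁⟩ := h.exists_isFrame_of_bdDist_le hd
  obtain ⟨C₂, h₂⟩ := h.exists_isFrame_of_lt_bdDist hd (m := κ / (2 + d) / 2) (by positivity)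
  refine ⟨max 1 (max C₁ C₂), le_max_left _ _, fun ξ hξ => ?_⟩
  rcases le_or_gt (bdDist Ω ξ) (κ / (2 + d) / 2) with hle | hlt
  · obtain ⟨z₀, b, i₀, lam, s, hf⟩ := h₁ ξ hξ hle
    exact ⟨z₀, b, i₀, lam, s, hf.mono ((le_max_left _ _).trans (le_max_right _ _))⟩
  · obtain ⟨z₀, b, i₀, lam, s, hf⟩ := h₂ ξ hξ hlt
    exact ⟨z₀, b, i₀, lam, s, hf.mono ((le_max_right _ _).trans (le_max_right _ _))⟩

end RollingBall

section PolyFrame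

variable {d : ℕ} (z₀ : EuclideanSpace ℝ (Fin d))
  (b : OrthonormalBasis (Fin d) ℝ (EuclideanSpace ℝ (Fin d))) (i₀ : Fin d) (lam : ℝ)
  {A B : Type*} [CommRing A] [Algebra ℝ A] [CommRing B] [Algebra ℝ B]

/-- The coordinates of `shear` with entries in a commutative `ℝ`-algebra. -/
def polyShear (w : Fin d → A) (i : Fin d) : A :=
  if i = i₀ then w i₀ + ∑ j ∈ Finset.univ.erase i₀, (w j - algebraMap ℝ A (1 / 2)) ^ 2
  else w i - algebraMap ℝ A (1 / 2)

/-- The coordinates of `frameMap` with entries in a commutative `ℝ`-algebra. -/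
def polyFrame (w : Fin d → A) (k : Fin d) : A :=
  algebraMap ℝ A (z₀ k) + algebraMap ℝ A lam * ∑ i, polyShear i₀ w i * algebraMap ℝ A (b i k)

theorem map_polyFrame (ψ : A →ₐ[ℝ] B) (w : Fin d → A) (k : Fin d) :
    ψ (polyFrame z₀ b i₀ lam w k) = polyFrame z₀ b i₀ lam (fun i => ψ (w i)) k := by
  simp only [polyFrame, polyShear, map_add, map_mul, map_sum, AlgHom.commutes,
    apply_ite ψ, map_sub, map_pow]

theorem polyFrame_real (u : Fin d → ℝ) (k : Fin d) :
    polyFrame z₀ b i₀ lam u k = frameMap z₀ b i₀ lam u k := by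
  have h : (b.repr.symm (WithLp.toLp 2 (shear i₀ u))) k = ∑ i, shear i₀ u i * b i k := by
    rw [← OrthonormalBasis.sum_repr_symm]
    simp
  simp [polyFrame, polyShear, frameMap, h, shear]

theorem natDegree_polyFrame_le (W : Fin d → Polynomial ℂ) (hW : ∀ i, (W i).natDegree ≤ 1)
    (k : Fin d) : (polyFrame z₀ b i₀ lam W k).natDegree ≤ 2 := by
  have hc : ∀ x : ℝ, (algebraMap ℝ (Polynomial ℂ) x).natDegree = 0 := fun x => by
    rw [IsScalarTower.algebraMap_apply ℝ ℂ (Polynomial ℂ), Polynomial.algebraMap_eq]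
    exact Polynomial.natDegree_C _
  have h1 : ∀ j x, (W j - algebraMap ℝ (Polynomial ℂ) x).natDegree ≤ 1 := fun j x =>
    (Polynomial.natDegree_sub_le_of_le (hW j) (hc x).le).trans (by simp)
  have h2 : ∀ i, (polyShear i₀ W i).natDegree ≤ 2 := fun i => by
    unfold polyShear
    split_ifs
    · refine Polynomial.natDegree_add_le_of_degree_le ((hW i₀).trans one_le_two) ?_
      refine Polynomial.natDegree_sum_le_of_forall_le _ _ fun j _ => ?_
      exact Polynomial.natDegree_pow_le_of_le 2 (h1 j _)
    · exact (h1 i _).trans one_le_two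
  refine Polynomial.natDegree_add_le_of_degree_le ((hc _).le.trans zero_le_two) ?_
  refine (Polynomial.natDegree_mul_le_of_le (hc _).le
    (Polynomial.natDegree_sum_le_of_forall_le (n := 2) _ _ fun i _ => ?_)).trans_eq (zero_add 2)
  exact Polynomial.natDegree_mul_le_of_le (h2 i) (hc _).le

/-- A polynomial in frame coordinates, extended to complex arguments. -/
def complexFrame (P : MvPolynomial (Fin d) ℝ) (w : Fin d → ℂ) : ℂ :=
  MvPolynomial.aeval (polyFrame z₀ b i₀ lam w) P

theorem complexFrame_ofReal (P : MvPolynomial (Fin d) ℝ) (u : Fin d → ℝ) :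
    complexFrame z₀ b i₀ lam P (fun i => (u i : ℂ)) =
      (MvPolynomial.eval (fun i => frameMap z₀ b i₀ lam u i) P : ℝ) := by
  have h := MvPolynomial.comp_aeval_apply (f := polyFrame z₀ b i₀ lam u) (Algebra.ofId ℝ ℂ) P
  simp only [map_polyFrame] at h
  simp only [funext (polyFrame_real z₀ b i₀ lam u), MvPolynomial.aeval_eq_eval] at h
  exact h.symm

theorem continuous_complexFrame (P : MvPolynomial (Fin d) ℝ) :
    Continuous (complexFrame z₀ b i₀ lam P) := by
  have h : ∀ w : Fin d → ℂ, complexFrame z₀ b i₀ lam P w =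
      MvPolynomial.eval (polyFrame z₀ b i₀ lam w) (P.map (algebraMap ℝ ℂ)) := fun w => by
    rw [complexFrame, MvPolynomial.eval_map]; rfl
  rw [funext h]
  refine (MvPolynomial.continuous_eval _).comp (continuous_pi fun k => ?_)
  unfold polyFrame
  refine continuous_const.add (continuous_const.mul (continuous_finsetSum _ fun i _ =>
    Continuous.mul ?_ continuous_const))
  unfold polyShear
  split_ifs <;> fun_prop

theorem exists_eval_eq_complexFrame {n : ℕ} (P : MvPolynomial (Fin d) ℝ) (hP : P.totalDegree ≤ n)
    (W : Fin d → Polynomial ℂ) (hW : ∀ i, (W i).natDegree ≤ 1) :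
    ∃ g : Polynomial ℂ, g.natDegree ≤ n * 2 ∧
      ∀ t, g.eval t = complexFrame z₀ b i₀ lam P (fun i => (W i).eval t) := by
  refine ⟨MvPolynomial.aeval (polyFrame z₀ b i₀ lam W) P, ?_, fun t => ?_⟩
  · have h1 : (P.map (algebraMap ℝ ℂ)).totalDegree ≤ n :=
      (Finset.sup_mono (MvPolynomial.support_map_subset _ _)).trans hP
    have h2 := MvPolynomial.aeval_natDegree_le _ h1 _ (natDegree_polyFrame_le z₀ b i₀ lam W hW)
    rwa [MvPolynomial.aeval_map_algebraMap] at h2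
  · have h := MvPolynomial.comp_aeval_apply (f := polyFrame z₀ b i₀ lam W)
      ((Polynomial.aeval t).restrictScalars ℝ) P
    simp only [map_polyFrame] at h
    simpa [complexFrame, Polynomial.coe_aeval_eq_eval] using h

theorem exists_eval_eq_complexFrame_update {n : ℕ} (P : MvPolynomial (Fin d) ℝ)
    (hP : P.totalDegree ≤ n) (i : Fin d) (v : Fin d → ℂ) :
    ∃ g : Polynomial ℂ, g.natDegree ≤ n * 2 ∧
      ∀ t, g.eval t = complexFrame z₀ b i₀ lam P (Function.update v i t) := by
  obtain ⟨g, hg, h⟩ := exists_eval_eq_complexFrame z₀ b i₀ lam P hP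
    (Function.update (fun j => Polynomial.C (v j)) i Polynomial.X) (fun j => by
      rcases eq_or_ne j i with rfl | hj
      · simp
      · simp [hj])
  refine ⟨g, hg, fun t => (h t).trans (congrArg _ (funext fun j => ?_))⟩
  rcases eq_or_ne j i with rfl | hj
  · simp
  · simp [hj]

theorem differentiable_complexFrame_line (P : MvPolynomial (Fin d) ℝ) (a c : Fin d → ℂ) :
    Differentiable ℂ fun t : ℂ => complexFrame z₀ b i₀ lam P (fun i => a i + t * c i) := by
  obtain ⟨g, -, h⟩ := exists_eval_eq_complexFrame z₀ b i₀ lam P le_rfl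
    (fun j => Polynomial.C (a j) + Polynomial.X * Polynomial.C (c j)) (fun j => by
      refine Polynomial.natDegree_add_le_of_degree_le (by simp) ?_
      exact Polynomial.natDegree_mul_le_of_le Polynomial.natDegree_X_le
        (Polynomial.natDegree_C _).le)
  have : (fun t : ℂ => complexFrame z₀ b i₀ lam P (fun i => a i + t * c i)) =
      fun t => g.eval t := by
    funext t
    simp only [h, Polynomial.eval_add, Polynomial.eval_mul, Polynomial.eval_C, Polynomial.eval_X]
  rw [this]
  exact g.differentiable

end PolyFrame

/-- The localized kernel associated with polynomials of degree `n`, decaying with order `m` in the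
distance to the point `c`. -/
def bdKernel {d : ℕ} (Ω : Set (EuclideanSpace ℝ (Fin d))) (n m : ℕ)
    (c x : EuclideanSpace ℝ (Fin d)) : ℝ :=
  (n : ℝ) ^ d / (√(bdDist Ω c) + 1 / (n : ℝ)) * ((1 + n * rhoMetric Ω c x) ^ m)⁻¹

theorem continuous_bdKernel {d : ℕ} (Ω : Set (EuclideanSpace ℝ (Fin d))) (n m : ℕ)
    (c : EuclideanSpace ℝ (Fin d)) : Continuous (bdKernel Ω n m c) := by
  have h := measurable_rhoMetric Ω c
  unfold bdKernel
  refine continuous_const.mul (Continuous.inv₀ (by fun_prop) fun x => ?_)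
  have : 0 ≤ rhoMetric Ω c x := rhoMetric_nonneg
  positivity

section FrameKernel

variable {d : ℕ} {Ω : Set (EuclideanSpace ℝ (Fin d))} {C : ℝ}
  {ξ z₀ : EuclideanSpace ℝ (Fin d)}
  {b : OrthonormalBasis (Fin d) ℝ (EuclideanSpace ℝ (Fin d))} {i₀ : Fin d} {lam s : ℝ}

theorem one_add_sum_le_prod_one_add {ι : Type*} (S : Finset ι) {a : ι → ℝ} (ha : ∀ i, 0 ≤ a i) :
    1 + ∑ i ∈ S, a i ≤ ∏ i ∈ S, (1 + a i) := by
  classical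
  induction S using Finset.induction_on with
  | empty => simp
  | insert i S hi ih =>
    rw [Finset.sum_insert hi, Finset.prod_insert hi]
    have := Finset.sum_nonneg (s := S) fun j _ => ha j
    nlinarith only [ih, this, ha i, mul_nonneg (ha i) this,
      mul_le_mul_of_nonneg_left ih (ha i)]

theorem IsFrame.prod_unitKernel_le (h : IsFrame Ω C ξ z₀ b i₀ lam s) (hC : 1 ≤ C) {C₁ : ℝ}
    (hC₁ : 0 ≤ C₁) {n : ℕ} (hn : 0 < n) (m : ℕ) {u : Fin d → ℝ}
    (hu : ∀ i, u i ∈ Icc (0 : ℝ) 1) :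
    ∏ i, (C₁ * unitKernel m (4 * n) (node i₀ s i) (u i)) ≤
      C₁ ^ d * (8 ^ d * (2 * C) * C ^ m) * bdKernel Ω n m ξ (frameMap z₀ b i₀ lam u) := by
  have hn' : (0 : ℝ) < n := by exact_mod_cast hn
  have hδ : 0 ≤ √(bdDist Ω ξ) := Real.sqrt_nonneg _
  have hs := h.s_nonneg
  have hρ : 0 ≤ rhoMetric Ω ξ (frameMap z₀ b i₀ lam u) := rhoMetric_nonneg
  have hden : 0 < √(bdDist Ω ξ) + 1 / (n : ℝ) := by positivity
  set a : Fin d → ℝ := fun i => |√(u i) - node i₀ s i| with ha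
  have ha0 : ∀ i, 0 ≤ a i := fun i => abs_nonneg _
  have hnode := fun i => node_nonneg (i₀ := i₀) hs i
  have e1 : ∏ i, (C₁ * unitKernel m (4 * n) (node i₀ s i) (u i)) =
      C₁ ^ d * ((∏ i, ((4 * n : ℕ) : ℝ) / (node i₀ s i + 1 / ((4 * n : ℕ) : ℝ))) *
        ((∏ i, (1 + ((4 * n : ℕ) : ℝ) * a i)) ^ m)⁻¹) := by
    simp only [unitKernel, Finset.prod_mul_distrib, Finset.prod_const, Finset.card_univ,
      Fintype.card_fin, Finset.prod_inv_distrib, Finset.prod_pow, ha]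
  have e2 : ∏ i, ((4 * n : ℕ) : ℝ) / (node i₀ s i + 1 / ((4 * n : ℕ) : ℝ)) ≤
      (8 * n) ^ d * (2 * C / (√(bdDist Ω ξ) + 1 / (n : ℝ))) := by
    have : ∏ i : Fin d, (8 * (n : ℝ) * if i = i₀ then 2 * C / (√(bdDist Ω ξ) + 1 / (n : ℝ)) else 1)
        = (8 * n) ^ d * (2 * C / (√(bdDist Ω ξ) + 1 / (n : ℝ))) := by
      rw [Finset.prod_mul_distrib]; simp
    rw [← this]
    refine Finset.prod_le_prod (fun i _ => ?_) fun i _ => ?_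
    · have := hnode i; positivity
    · have hni := hnode i
      push_cast
      split_ifs with hi
      · subst hi
        have e : node i s i = s := by simp [node]
        rw [e, ← mul_div_assoc, div_le_div_iff₀ (by positivity) hden]
        have h1 := h.le_s
        have h2 : (n : ℝ) * √(bdDist Ω ξ) ≤ n * (C * s) := by gcongr
        have h3 : (n : ℝ) * s ≤ n * s * C := le_mul_of_one_le_right (by positivity) hC
        have e3 : 4 * (n : ℝ) * (√(bdDist Ω ξ) + 1 / n) = 4 * (n * √(bdDist Ω ξ)) + 4 := by
          field_simp
        have e4 : 8 * (n : ℝ) * (2 * C) * (s + 1 / (4 * n)) = 16 * (n * (C * s)) + 4 * C := by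
          field_simp; ring
        rw [e3, e4]
        have : 0 ≤ (n : ℝ) * (C * s) := by positivity
        linarith only [h2, hC, this]
      · have h1 := half_le_node_of_ne (s := s) hi
        rw [mul_one, div_le_iff₀ (by positivity)]
        have : 0 < 1 / (4 * (n : ℝ)) := by positivity
        nlinarith only [h1, hn', mul_pos hn' this, mul_le_mul_of_nonneg_left h1 hn'.le]
  have e3 : (1 + n * rhoMetric Ω ξ (frameMap z₀ b i₀ lam u)) / C ≤
      ∏ i, (1 + ((4 * n : ℕ) : ℝ) * a i) := by
    refine le_trans ?_ (one_add_sum_le_prod_one_add _ fun i => mul_nonneg (Nat.cast_nonneg _) (ha0 i))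
    rw [← Finset.mul_sum, div_le_iff₀ (by linarith)]
    have h1 := h.rho_le u hu
    have hS : 0 ≤ ∑ i, a i := Finset.sum_nonneg fun i _ => ha0 i
    have h2 : n * rhoMetric Ω ξ (frameMap z₀ b i₀ lam u) ≤ n * (C * ∑ i, a i) := by gcongr
    have h3 : 0 ≤ n * (C * ∑ i, a i) := by positivity
    push_cast
    nlinarith only [h2, h3, hC]
  rw [e1, bdKernel]
  have e4 : ((∏ i, (1 + ((4 * n : ℕ) : ℝ) * a i)) ^ m)⁻¹ ≤
      C ^ m * ((1 + n * rhoMetric Ω ξ (frameMap z₀ b i₀ lam u)) ^ m)⁻¹ := by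
    have := inv_anti₀ (by positivity) (pow_le_pow_left₀ (by positivity) e3 m)
    refine this.trans_eq ?_
    rw [div_pow, inv_div, div_eq_mul_inv]
  calc _ ≤ C₁ ^ d * (((8 * n) ^ d * (2 * C / (√(bdDist Ω ξ) + 1 / (n : ℝ)))) *
        (C ^ m * ((1 + n * rhoMetric Ω ξ (frameMap z₀ b i₀ lam u)) ^ m)⁻¹)) := by
        gcongr
    _ = _ := by rw [mul_pow]; ring

theorem IsFrame.enorm_complexFrame_le (hC : 1 ≤ C) (hΩ : MeasurableSet Ω) (m : ℕ) :
    ∃ C' : ℝ, 0 < C' ∧ ∀ {ξ z₀ b i₀ lam s}, IsFrame Ω C ξ z₀ b i₀ lam s → ∀ n : ℕ, 0 < n →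
      ∀ P : MvPolynomial (Fin d) ℝ, P.totalDegree ≤ n → ∀ w : Fin d → ℂ,
      (∀ i, ‖w i - (frameCenter i₀ s i : ℝ)‖ ≤
        1 / (4 * (n : ℝ)) * (node i₀ s i + 1 / (4 * (n : ℝ))) / 8) →
      ‖complexFrame z₀ b i₀ lam P w‖ₑ ≤
        ∫⁻ z in Ω, ‖MvPolynomial.eval (fun i => z i) P‖ₑ *
          ENNReal.ofReal (C' * bdKernel Ω n m ξ z) := by
  obtain ⟨C₁, hC₁, hunit⟩ := exists_enorm_eval_le_lintegral_unit m
  have hC0 : 0 < C := by linarith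
  refine ⟨C ^ d * (C₁ ^ d * (8 ^ d * (2 * C) * C ^ m)), by positivity, ?_⟩
  intro ξ z₀ b i₀ lam s h n hn P hP w hw
  set C₂ := C₁ ^ d * (8 ^ d * (2 * C) * C ^ m) with hC₂
  have hC₂0 : 0 < C₂ := by positivity
  set k : Fin d → ℝ → ℝ≥0∞ := fun i t =>
    ENNReal.ofReal (C₁ * unitKernel m (4 * n) (node i₀ s i) t) with hk
  have hkm : ∀ i, Measurable (k i) := fun i => by
    simp only [hk, unitKernel]; fun_prop
  have hpi := enorm_le_lintegral_pi (continuous_complexFrame z₀ b i₀ lam P) hkm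
    (volume.restrict (Icc (0 : ℝ) 1)) (w := w) (fun i v => by
      obtain ⟨g, hg, hgv⟩ := exists_eval_eq_complexFrame_update z₀ b i₀ lam P hP i v
      have := hunit (4 * n) (by omega) g (by omega) (node i₀ s i) (node_nonneg h.s_nonneg i)
        (center_le h.s_sq_le i) (w i) (by
          have := hw i
          rw [frameCenter] at this
          push_cast at this ⊢
          exact this)
      simpa only [hgv] using this)
  refine hpi.trans ?_
  set F : EuclideanSpace ℝ (Fin d) → ℝ≥0∞ := Ω.indicator fun z =>
    ‖MvPolynomial.eval (fun i => z i) P‖ₑ * ENNReal.ofReal (C₂ * bdKernel Ω n m ξ z) with hF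
  have hPm : Continuous fun z : EuclideanSpace ℝ (Fin d) => MvPolynomial.eval (fun i => z i) P :=
    (MvPolynomial.continuous_eval P).comp (by fun_prop)
  have hker := continuous_bdKernel Ω n m ξ
  have hm : Measurable fun z => ‖MvPolynomial.eval (fun i => z i) P‖ₑ *
      ENNReal.ofReal (C₂ * bdKernel Ω n m ξ z) :=
    hPm.measurable.enorm.mul (by fun_prop)
  have hFm : Measurable F := hm.indicator hΩ
  rw [← Measure.restrict_pi_pi]
  calc _ ≤ ∫⁻ u in Set.pi univ fun _ => Icc (0 : ℝ) 1, F (frameMap z₀ b i₀ lam u)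
        ∂(Measure.pi fun _ => volume) := by
        refine setLIntegral_mono' (MeasurableSet.univ_pi fun _ => measurableSet_Icc) ?_
        intro u hu
        have hu' : ∀ i, u i ∈ Icc (0 : ℝ) 1 := fun i => hu i (mem_univ i)
        rw [hF, indicator_of_mem (h.mem u hu'), complexFrame_ofReal]
        have e1 : ‖((MvPolynomial.eval (fun i => frameMap z₀ b i₀ lam u i) P : ℝ) : ℂ)‖ₑ =
            ‖MvPolynomial.eval (fun i => frameMap z₀ b i₀ lam u i) P‖ₑ := by
          rw [← ofReal_norm, ← ofReal_norm, Complex.norm_real]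
        rw [e1]
        gcongr
        rw [hk, ← ENNReal.ofReal_prod_of_nonneg]
        · exact ENNReal.ofReal_le_ofReal (h.prod_unitKernel_le hC hC₁.le hn m hu')
        · intro i _
          have := node_nonneg (i₀ := i₀) h.s_nonneg i
          unfold unitKernel; positivity
    _ ≤ ∫⁻ u, F (frameMap z₀ b i₀ lam u) := by
        rw [← volume_pi]; exact setLIntegral_le_lintegral _ _
    _ = ENNReal.ofReal ((lam ^ d)⁻¹) * ∫⁻ z, F z := lintegral_comp_frameMap z₀ b i₀ h.lam_pos hFm
    _ ≤ ENNReal.ofReal (C ^ d) * ∫⁻ z, F z := by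
        gcongr
        rw [← inv_pow]
        exact pow_le_pow_left₀ (inv_nonneg.mpr h.lam_pos.le) h.inv_lam_le d
    _ = _ := by
        rw [hF, lintegral_indicator hΩ, ← lintegral_const_mul _ hm]
        refine lintegral_congr fun z => ?_
        rw [mul_left_comm, ← ENNReal.ofReal_mul (by positivity), ← mul_assoc (C ^ d)]

end FrameKernel

section KernelComparison

variable {d : ℕ} {Ω : Set (EuclideanSpace ℝ (Fin d))} {c x z : EuclideanSpace ℝ (Fin d)} {n m : ℕ}

theorem bdKernel_le_of_rhoMetric_le (hn : 0 < n) {R : ℝ} (hR : 0 ≤ R)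
    (h : rhoMetric Ω c x ≤ R / n) :
    bdKernel Ω n m x z ≤ (1 + R) ^ (m + 1) * bdKernel Ω n m c z := by
  have hn' : (0 : ℝ) < n := by exact_mod_cast hn
  have h1 : 0 ≤ rhoMetric Ω x z := rhoMetric_nonneg
  have h2 : 0 ≤ rhoMetric Ω c z := rhoMetric_nonneg
  have hx := Real.sqrt_nonneg (bdDist Ω x)
  have hc := Real.sqrt_nonneg (bdDist Ω c)
  have h3 : √(bdDist Ω c) + 1 / (n : ℝ) ≤ (1 + R) * (√(bdDist Ω x) + 1 / n) := by
    have := sqrt_bdDist_le (Ω := Ω) (x := x) (y := c)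
    rw [rhoMetric_comm] at this
    have h4 : (1 + R) * (√(bdDist Ω x) + 1 / (n : ℝ)) =
      √(bdDist Ω x) + 1 / n + R / n + R * √(bdDist Ω x) := by ring
    have := mul_nonneg hR hx
    linarith
  have h4 : 1 + n * rhoMetric Ω c z ≤ (1 + R) * (1 + n * rhoMetric Ω x z) := by
    have := rhoMetric_triangle (Ω := Ω) (x := c) (y := x) (z := z)
    have h5 : (n : ℝ) * rhoMetric Ω c z ≤ n * (R / n + rhoMetric Ω x z) := by
      gcongr; linarith
    rw [mul_add, mul_div_cancel₀ _ hn'.ne'] at h5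
    have h6 : 0 ≤ R * (n * rhoMetric Ω x z) := by positivity
    nlinarith only [h5, h6]
  have e1 : (n : ℝ) ^ d / (√(bdDist Ω x) + 1 / (n : ℝ)) ≤
      (1 + R) * ((n : ℝ) ^ d / (√(bdDist Ω c) + 1 / (n : ℝ))) := by
    rw [← mul_div_assoc, div_le_div_iff₀ (by positivity) (by positivity)]
    calc (n : ℝ) ^ d * (√(bdDist Ω c) + 1 / n)
        ≤ (n : ℝ) ^ d * ((1 + R) * (√(bdDist Ω x) + 1 / n)) := by gcongr
      _ = _ := by ring
  have e2 : ((1 + n * rhoMetric Ω x z) ^ m)⁻¹ ≤ (1 + R) ^ m * ((1 + n * rhoMetric Ω c z) ^ m)⁻¹ := by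
    rw [← div_eq_mul_inv, le_div_iff₀ (by positivity), inv_mul_le_iff₀ (by positivity), ← mul_pow]
    exact pow_le_pow_left₀ (by positivity) (h4.trans_eq (mul_comm _ _)) m
  calc bdKernel Ω n m x z ≤ ((1 + R) * ((n : ℝ) ^ d / (√(bdDist Ω c) + 1 / (n : ℝ)))) *
        ((1 + R) ^ m * ((1 + n * rhoMetric Ω c z) ^ m)⁻¹) := by
        unfold bdKernel; gcongr
    _ = _ := by unfold bdKernel; ring

theorem bdKernel_succ_le_swap (hn : 0 < n) : bdKernel Ω n (m + 1) c z ≤ bdKernel Ω n m z c := by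
  have hn' : (0 : ℝ) < n := by exact_mod_cast hn
  have h2 : 0 ≤ rhoMetric Ω c z := rhoMetric_nonneg
  have hz := Real.sqrt_nonneg (bdDist Ω z)
  have hc := Real.sqrt_nonneg (bdDist Ω c)
  have h3 : √(bdDist Ω z) + 1 / (n : ℝ) ≤
      (√(bdDist Ω c) + 1 / n) * (1 + n * rhoMetric Ω c z) := by
    have h4 := sqrt_bdDist_le (Ω := Ω) (x := c) (y := z)
    have h5 : (√(bdDist Ω c) + 1 / n) * (1 + n * rhoMetric Ω c z) =
        √(bdDist Ω c) + 1 / n + rhoMetric Ω c z + √(bdDist Ω c) * (n * rhoMetric Ω c z) := by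
      field_simp
      ring
    have : 0 ≤ √(bdDist Ω c) * (n * rhoMetric Ω c z) := by positivity
    linarith
  unfold bdKernel
  rw [rhoMetric_comm (x := z), pow_succ (1 + n * rhoMetric Ω c z), ← div_eq_mul_inv,
    ← div_eq_mul_inv, div_div, div_div]
  refine div_le_div_of_nonneg_left (by positivity) (by positivity) ?_
  calc (√(bdDist Ω z) + 1 / n) * (1 + n * rhoMetric Ω c z) ^ m
      ≤ ((√(bdDist Ω c) + 1 / n) * (1 + n * rhoMetric Ω c z)) * (1 + n * rhoMetric Ω c z) ^ m := by
        gcongr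
    _ = _ := by ring

theorem bdKernel_succ_le : bdKernel Ω n (m + 1) c z ≤ bdKernel Ω n m c z := by
  have h2 : 0 ≤ rhoMetric Ω c z := rhoMetric_nonneg
  have : (1 : ℝ) ≤ 1 + n * rhoMetric Ω c z := le_add_of_nonneg_right (by positivity)
  unfold bdKernel
  gcongr
  omega

end KernelComparison

section Oscillation

variable {d : ℕ} {Ω : Set (EuclideanSpace ℝ (Fin d))} {C : ℝ}

/-- The kernel average of `|f|` around `c`. -/
def kernelAverage (Ω : Set (EuclideanSpace ℝ (Fin d))) (n m : ℕ)
    (f : EuclideanSpace ℝ (Fin d) → ℝ) (c : EuclideanSpace ℝ (Fin d)) : ℝ≥0∞ :=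
  ∫⁻ z in Ω, ‖f z‖ₑ * ENNReal.ofReal (bdKernel Ω n m c z)

theorem IsPolyDeg.continuous {n : ℕ} {f : EuclideanSpace ℝ (Fin d) → ℝ} (hf : IsPolyDeg n f) :
    Continuous f := by
  obtain ⟨P, -, h⟩ := hf
  rw [funext h]
  exact (MvPolynomial.continuous_eval P).comp (by fun_prop)

theorem lintegral_mul_ofReal_mul_bdKernel {C' : ℝ} (hC' : 0 ≤ C') (n m : ℕ)
    {f : EuclideanSpace ℝ (Fin d) → ℝ} (hf : Continuous f) (c : EuclideanSpace ℝ (Fin d)) :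
    ∫⁻ z in Ω, ‖f z‖ₑ * ENNReal.ofReal (C' * bdKernel Ω n m c z) =
      ENNReal.ofReal C' * kernelAverage Ω n m f c := by
  have hk := continuous_bdKernel Ω n m c
  rw [kernelAverage, ← lintegral_const_mul _ (by fun_prop)]
  refine lintegral_congr fun z => ?_
  rw [ENNReal.ofReal_mul hC', mul_left_comm]

theorem kernelAverage_le_of_rhoMetric_le {n m : ℕ} (hn : 0 < n) {R : ℝ} (hR : 0 ≤ R)
    {c x : EuclideanSpace ℝ (Fin d)} (h : rhoMetric Ω c x ≤ R / n)
    {f : EuclideanSpace ℝ (Fin d) → ℝ} (hf : Continuous f) :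
    kernelAverage Ω n m f x ≤ ENNReal.ofReal ((1 + R) ^ (m + 1)) * kernelAverage Ω n m f c := by
  rw [← lintegral_mul_ofReal_mul_bdKernel (by positivity) n m hf]
  refine lintegral_mono fun z => ?_
  gcongr
  exact bdKernel_le_of_rhoMetric_le hn hR h

theorem enorm_sub_le_of_complexFrame_le {P : MvPolynomial (Fin d) ℝ}
    {z₀ : EuclideanSpace ℝ (Fin d)} {b : OrthonormalBasis (Fin d) ℝ (EuclideanSpace ℝ (Fin d))}
    {i₀ : Fin d} {lam : ℝ} {a u r : Fin d → ℝ} {M q : ℝ} (hq : 0 < q) (hq1 : q < 1)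
    (hu : ∀ i, |u i - a i| ≤ q * r i)
    (hG : ∀ w : Fin d → ℂ, (∀ i, ‖w i - (a i : ℂ)‖ ≤ r i) → ‖complexFrame z₀ b i₀ lam P w‖ ≤ M) :
    |MvPolynomial.eval (fun i => frameMap z₀ b i₀ lam u i) P -
      MvPolynomial.eval (fun i => frameMap z₀ b i₀ lam a i) P| ≤ 2 * M * q := by
  set g : ℂ → ℂ := fun t => complexFrame z₀ b i₀ lam P
    (fun i => (a i : ℂ) + t * ((u i - a i : ℝ) : ℂ)) with hg
  have hgd : Differentiable ℂ g := differentiable_complexFrame_line z₀ b i₀ lam P _ _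
  have hgM : ∀ t ∈ Metric.ball (0 : ℂ) (1 / q), ‖g t‖ ≤ M := fun t ht => by
    refine hG _ fun i => ?_
    rw [mem_ball_zero_iff] at ht
    rw [add_sub_cancel_left, norm_mul, Complex.norm_real, Real.norm_eq_abs]
    calc ‖t‖ * |u i - a i| ≤ 1 / q * (q * r i) := by gcongr; exact hu i
      _ = r i := by field_simp
  have h0 : (0 : ℂ) ∈ Metric.ball (0 : ℂ) (1 / q) := Metric.mem_ball_self (by positivity)
  have h1 : (1 : ℂ) ∈ Metric.ball (0 : ℂ) (1 / q) := by
    rw [mem_ball_zero_iff, norm_one, lt_div_iff₀ hq, one_mul]; exact hq1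
  have hs := Complex.dist_le_div_mul_dist_of_mapsTo_ball (R₂ := 2 * M) hgd.differentiableOn
    (fun t ht => by
      rw [Metric.mem_closedBall, dist_eq_norm]
      have := norm_sub_le (g t) (g 0)
      linarith [hgM t ht, hgM 0 h0]) h1
  have e1 : g 1 = (MvPolynomial.eval (fun i => frameMap z₀ b i₀ lam u i) P : ℝ) := by
    rw [hg, ← complexFrame_ofReal]
    simp
  have e0 : g 0 = (MvPolynomial.eval (fun i => frameMap z₀ b i₀ lam a i) P : ℝ) := by
    rw [hg, ← complexFrame_ofReal]
    simp
  rw [e0, e1, dist_eq_norm, ← Complex.ofReal_sub, Complex.norm_real, Real.norm_eq_abs,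
    dist_zero_right, norm_one, mul_one, div_div_eq_mul_div, div_one] at hs
  exact hs

theorem exists_enorm_sub_le_kernelAverage (hC : 1 ≤ C) (hΩ : MeasurableSet Ω)
    (hfr : ∀ ξ ∈ Ω, ∃ z₀ b i₀ lam s, IsFrame Ω C ξ z₀ b i₀ lam s) (m : ℕ) {ℓ : ℝ} (hℓ : 1 ≤ ℓ) :
    ∃ A : ℝ, 0 < A ∧ ∀ n : ℕ, 0 < n → ∀ ε : ℝ, 0 < ε → ε < ℓ →
      ∀ f : EuclideanSpace ℝ (Fin d) → ℝ, IsPolyDeg n f → ∀ ξ ∈ Ω, ∀ x ∈ Ω,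
      rhoMetric Ω ξ x ≤ ℓ * ε / n →
      ‖f x - f ξ‖ₑ ≤ ENNReal.ofReal (A * ε) * kernelAverage Ω n m f ξ := by
  obtain ⟨C', hC', hmain⟩ := IsFrame.enorm_complexFrame_le (d := d) hC hΩ m
  set B := C' * (2 * (1 + ℓ ^ 2) ^ (m + 1)) with hB
  have hB0 : 0 < B := by positivity
  have hC0 : 0 < C := by linarith
  refine ⟨64 * C * ℓ * (C' + B), by positivity, ?_⟩
  intro n hn ε hε hεℓ f hf ξ hξ x hx hρ
  have hfc := hf.continuous
  have hn' : (0 : ℝ) < n := by exact_mod_cast hn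
  have hn1 : (1 : ℝ) ≤ n := by exact_mod_cast hn
  obtain ⟨P, hP, hfP⟩ := hf
  have hsup : ∀ y ∈ Ω, ‖f y‖ₑ ≤ ENNReal.ofReal C' * kernelAverage Ω n m f y := fun y hy => by
    obtain ⟨z₀, b, i₀, lam, s, h⟩ := hfr y hy
    have h1 := hmain h n hn P hP (fun i => (frameCenter i₀ s i : ℝ)) (fun i => by
      have := node_nonneg (i₀ := i₀) h.s_nonneg i
      rw [sub_self, norm_zero]; positivity)
    rw [complexFrame_ofReal, h.map_center, ← hfP, ← ofReal_norm, Complex.norm_real,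
      ofReal_norm] at h1
    simp only [← hfP] at h1
    rwa [lintegral_mul_ofReal_mul_bdKernel hC'.le n m hfc] at h1
  rcases le_or_gt (1 / (64 * C * ℓ)) ε with hbig | hsmall
  · have hρ2 : rhoMetric Ω ξ x ≤ ℓ ^ 2 / n := hρ.trans (by rw [sq]; gcongr)
    have hone : 1 ≤ (1 + ℓ ^ 2) ^ (m + 1) := one_le_pow₀ (le_add_of_nonneg_right (sq_nonneg ℓ))
    calc ‖f x - f ξ‖ₑ ≤ ‖f x‖ₑ + ‖f ξ‖ₑ := enorm_sub_le
      _ ≤ ENNReal.ofReal C' * (ENNReal.ofReal ((1 + ℓ ^ 2) ^ (m + 1)) * kernelAverage Ω n m f ξ) +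
          ENNReal.ofReal C' * (ENNReal.ofReal ((1 + ℓ ^ 2) ^ (m + 1)) * kernelAverage Ω n m f ξ) := by
        refine add_le_add ((hsup x hx).trans ?_) ((hsup ξ hξ).trans ?_)
        · gcongr
          exact kernelAverage_le_of_rhoMetric_le hn (sq_nonneg ℓ) hρ2 hfc
        · gcongr
          exact le_mul_of_one_le_left' (ENNReal.one_le_ofReal.mpr hone)
      _ = ENNReal.ofReal B * kernelAverage Ω n m f ξ := by
        rw [hB, ENNReal.ofReal_mul hC'.le, ENNReal.ofReal_mul zero_le_two, ENNReal.ofReal_ofNat]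
        ring
      _ ≤ _ := by
        gcongr
        rw [div_le_iff₀ (by positivity)] at hbig
        calc B = 1 * B := (one_mul B).symm
          _ ≤ (ε * (64 * C * ℓ)) * (C' + B) := by gcongr; linarith
          _ = _ := by ring
  · rcases eq_or_ne (kernelAverage Ω n m f ξ) ∞ with hI | hI
    · rw [hI, ENNReal.mul_top (by simpa using by positivity)]
      exact le_top
    obtain ⟨z₀, b, i₀, lam, s, h⟩ := hfr ξ hξ
    obtain ⟨u, rfl⟩ := frameMap_surjective z₀ b i₀ h.lam_pos x
    set I := (kernelAverage Ω n m f ξ).toReal with hIdef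
    have hsmall' : 64 * C * (ℓ * ε) < 1 := by
      rw [lt_div_iff₀ (by positivity)] at hsmall; linarith
    have hT : ℓ * ε ≤ 1 / 4 := by
      have : ℓ * ε ≤ C * (ℓ * ε) := le_mul_of_one_le_left (by positivity) hC
      linarith
    set r : Fin d → ℝ := fun i =>
      1 / (4 * (n : ℝ)) * (node i₀ s i + 1 / (4 * (n : ℝ))) / 8 with hr
    have hnode := fun i => node_nonneg (i₀ := i₀) h.s_nonneg i
    have hsub := enorm_sub_le_of_complexFrame_le (P := P) (z₀ := z₀) (b := b) (i₀ := i₀)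
      (lam := lam) (a := frameCenter i₀ s) (u := u) (r := r) (M := C' * I) (q := 32 * C * (ℓ * ε))
      (by positivity) (by linarith)
      (fun i => by
        have hni := hnode i
        refine (h.near (ℓ * ε / n) u ?_ hx hρ i).trans ?_
        · rw [div_le_iff₀ hn', ← div_eq_inv_mul, le_div_iff₀ hC0]
          nlinarith only [hsmall', hn1, mul_pos hC0 (mul_pos (zero_lt_one.trans_le hℓ) hε)]
        · calc C * (ℓ * ε / n) * (node i₀ s i + ℓ * ε / n)
              ≤ C * (ℓ * ε / n) * (node i₀ s i + (1 / 4) / n) := by gcongr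
            _ = 32 * C * (ℓ * ε) * r i := by rw [hr]; field_simp; ring)
      (fun w hw => by
        have h1 := hmain h n hn P hP w hw
        simp only [← hfP] at h1
        rw [lintegral_mul_ofReal_mul_bdKernel hC'.le n m hfc, ← ENNReal.ofReal_toReal hI,
          ← ENNReal.ofReal_mul hC'.le, ← ofReal_norm,
          ENNReal.ofReal_le_ofReal_iff (by positivity)] at h1
        exact h1)
    rw [h.map_center, ← hfP, ← hfP] at hsub
    rw [← ENNReal.ofReal_toReal hI, ← ENNReal.ofReal_mul (by positivity), ← ofReal_norm,
      Real.norm_eq_abs]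
    refine ENNReal.ofReal_le_ofReal (hsub.trans ?_)
    have hI0 : 0 ≤ I := ENNReal.toReal_nonneg
    calc 2 * (C' * I) * (32 * C * (ℓ * ε)) = 64 * C * ℓ * C' * ε * I := by ring
      _ ≤ 64 * C * ℓ * (C' + B) * ε * I := by gcongr; linarith

theorem exists_osc_le_kernelAverage (hC : 1 ≤ C) (hΩ : MeasurableSet Ω)
    (hfr : ∀ ξ ∈ Ω, ∃ z₀ b i₀ lam s, IsFrame Ω C ξ z₀ b i₀ lam s) (m : ℕ) {ℓ : ℝ} (hℓ : 1 ≤ ℓ) :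
    ∃ A : ℝ, 0 < A ∧ ∀ n : ℕ, 0 < n → ∀ ε : ℝ, 0 < ε → ε < ℓ →
      ∀ f : EuclideanSpace ℝ (Fin d) → ℝ, IsPolyDeg n f → ∀ ξ ∈ Ω,
      ENNReal.ofReal (osc f (Uball Ω ξ (ℓ * ε / n))) ≤
        ENNReal.ofReal (A * ε) * kernelAverage Ω n m f ξ := by
  obtain ⟨A, hA, h⟩ := exists_enorm_sub_le_kernelAverage hC hΩ hfr m hℓ
  refine ⟨2 * A, by positivity, fun n hn ε hε hεℓ f hf ξ hξ => ?_⟩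
  rcases eq_or_ne (kernelAverage Ω n m f ξ) ∞ with hI | hI
  · rw [hI, ENNReal.mul_top (by simpa using by positivity)]
    exact le_top
  refine (ENNReal.ofReal_le_iff_le_toReal (ENNReal.mul_ne_top ENNReal.ofReal_ne_top hI)).mpr ?_
  refine Real.sSup_le ?_ ENNReal.toReal_nonneg
  rintro _ ⟨x, hx, y, hy, rfl⟩
  refine (ENNReal.ofReal_le_iff_le_toReal (ENNReal.mul_ne_top ENNReal.ofReal_ne_top hI)).mp ?_
  have hx' := h n hn ε hε hεℓ f hf ξ hξ x hx.1 hx.2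
  have hy' := h n hn ε hε hεℓ f hf ξ hξ y hy.1 hy.2
  rw [← Real.norm_eq_abs, ofReal_norm]
  calc ‖f x - f y‖ₑ = ‖(f x - f ξ) - (f y - f ξ)‖ₑ := by rw [sub_sub_sub_cancel_right]
    _ ≤ ‖f x - f ξ‖ₑ + ‖f y - f ξ‖ₑ := enorm_sub_le
    _ ≤ _ := add_le_add hx' hy'
    _ = _ := by
      rw [mul_assoc 2, ENNReal.ofReal_mul zero_le_two, ENNReal.ofReal_ofNat]; ring

end Oscillation

section Volume

variable {d : ℕ} {Ω : Set (EuclideanSpace ℝ (Fin d))} {C : ℝ}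

theorem measurableSet_Uball (hΩ : MeasurableSet Ω) (ξ : EuclideanSpace ℝ (Fin d)) (t : ℝ) :
    MeasurableSet (Uball Ω ξ t) :=
  hΩ.inter (measurableSet_le (measurable_rhoMetric Ω ξ).measurable measurable_const)

theorem IsFrame.volume_Uball_le {ξ z₀ : EuclideanSpace ℝ (Fin d)}
    {b : OrthonormalBasis (Fin d) ℝ (EuclideanSpace ℝ (Fin d))} {i₀ : Fin d} {lam s : ℝ}
    (h : IsFrame Ω C ξ z₀ b i₀ lam s) (hC : 1 ≤ C) (hΩ : MeasurableSet Ω) {t : ℝ} (ht : 0 < t)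
    (htC : t ≤ C⁻¹) :
    volume (Uball Ω ξ t) ≤ ENNReal.ofReal (C ^ d * ((4 * C) ^ d * C) * (t ^ d * (√(bdDist Ω ξ) + t))) := by
  have hC0 : 0 < C := by linarith
  have ht1 : t ≤ 1 := htC.trans (inv_le_one_of_one_le₀ hC)
  have hδ := Real.sqrt_nonneg (bdDist Ω ξ)
  have hnode := fun i => node_nonneg (i₀ := i₀) h.s_nonneg i
  set r : Fin d → ℝ := fun i => C * t * (node i₀ s i + t) with hr
  have hr0 : ∀ i, 0 ≤ r i := fun i => by have := hnode i; positivity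
  have hsub : frameMap z₀ b i₀ lam ⁻¹' Uball Ω ξ t ⊆
      Set.pi univ fun i => Icc (frameCenter i₀ s i - r i) (frameCenter i₀ s i + r i) := by
    rintro u ⟨hu1, hu2⟩ i -
    have := abs_le.mp (h.near t u htC hu1 hu2 i)
    exact ⟨by linarith [this.1], by linarith [this.2]⟩
  have hprod : ∏ i, (2 * r i) ≤ (4 * C) ^ d * C * (t ^ d * (√(bdDist Ω ξ) + t)) := by
    have e : ∏ i : Fin d, (4 * C * t * if i = i₀ then C * (√(bdDist Ω ξ) + t) else 1) =
        (4 * C) ^ d * C * (t ^ d * (√(bdDist Ω ξ) + t)) := by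
      rw [Finset.prod_mul_distrib]; simp; ring
    rw [← e]
    refine Finset.prod_le_prod (fun i _ => by have := hr0 i; positivity) fun i _ => ?_
    simp only [hr]
    split_ifs with hi
    · subst hi
      have e2 : node i s i = s := by simp [node]
      have h1 : s + t ≤ C * (√(bdDist Ω ξ) + t) := by
        have := h.s_le
        have := le_mul_of_one_le_left ht.le hC
        linarith
      rw [e2]
      have h2 : 0 ≤ C * t := by positivity
      have h3 : 0 ≤ C * t * (C * (√(bdDist Ω ξ) + t)) := by positivity
      linarith [mul_le_mul_of_nonneg_left h1 h2]
    · have := node_le_one (i₀ := i₀) h.s_sq_le i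
      have h2 : 0 ≤ C * t := by positivity
      have : C * t * (node i₀ s i + t) ≤ C * t * 2 := by gcongr; linarith
      linarith
  rw [volume_preimage_frameMap z₀ b i₀ h.lam_pos (measurableSet_Uball hΩ ξ t), mul_assoc (C ^ d),
    ENNReal.ofReal_mul (by positivity)]
  refine mul_le_mul' (ENNReal.ofReal_le_ofReal (pow_le_pow_left₀ h.lam_pos.le h.lam_le d)) ?_
  refine (measure_mono hsub).trans ?_
  rw [volume_pi_pi]
  simp only [Real.volume_Icc, add_sub_sub_cancel, ← two_mul]
  rw [← ENNReal.ofReal_prod_of_nonneg fun i _ => by have := hr0 i; positivity]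
  exact ENNReal.ofReal_le_ofReal hprod

theorem IsFrame.le_volume_Uball {ξ z₀ : EuclideanSpace ℝ (Fin d)}
    {b : OrthonormalBasis (Fin d) ℝ (EuclideanSpace ℝ (Fin d))} {i₀ : Fin d} {lam s : ℝ}
    (h : IsFrame Ω C ξ z₀ b i₀ lam s) (hd : 0 < d) (hC : 1 ≤ C) (hΩ : MeasurableSet Ω) {t T : ℝ}
    (ht : 0 < t) (htT : t ≤ T) (hT : 1 ≤ T) :
    ENNReal.ofReal ((C⁻¹) ^ d * ((4 * T * d * C)⁻¹ ^ d * (4 * T * d * C)⁻¹) *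
      (t ^ d * (√(bdDist Ω ξ) + t))) ≤ volume (Uball Ω ξ t) := by
  have hC0 : 0 < C := by linarith
  have hT0 : 0 < T := by linarith
  have hd1 : (1 : ℝ) ≤ d := by exact_mod_cast hd
  have hd0 : (0 : ℝ) < d := by linarith
  have hδ := Real.sqrt_nonneg (bdDist Ω ξ)
  have hnode := fun i => node_nonneg (i₀ := i₀) h.s_nonneg i
  set K := 4 * T * d * C with hK
  have hK0 : 0 < K := by positivity
  set τ := t * K⁻¹ with hτ
  have hτ0 : 0 < τ := by positivity
  have hτK : τ * K = t := by rw [hτ, mul_assoc, inv_mul_cancel₀ hK0.ne', mul_one]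
  have hdC : 1 ≤ d * C := one_le_mul_of_one_le_of_one_le hd1 hC
  have hτ1 : τ ≤ 1 / 4 := by
    rw [hτ, ← div_eq_mul_inv, div_le_iff₀ hK0, hK]
    nlinarith only [htT, mul_le_mul_of_nonneg_left hdC hT0.le]
  have hτd : C * (d * τ) ≤ t := by
    have h1 : 1 ≤ 4 * T := by linarith
    calc C * (d * τ) = 1 * (C * (d * τ)) := (one_mul _).symm
      _ ≤ 4 * T * (C * (d * τ)) := by gcongr
      _ = t := by rw [← hτK, hK]; ring
  have hsub : (Set.pi univ fun i => Icc (node i₀ s i ^ 2) ((node i₀ s i + τ) ^ 2)) ⊆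
      frameMap z₀ b i₀ lam ⁻¹' Uball Ω ξ t := by
    intro u hu
    have hsq : ∀ i, |√(u i) - node i₀ s i| ≤ τ := fun i => by
      have h1 := Real.le_sqrt_of_sq_le (hu i trivial).1
      have h2 := Real.sqrt_le_sqrt (hu i trivial).2
      rw [Real.sqrt_sq (by have := hnode i; positivity)] at h2
      exact abs_le.mpr ⟨by linarith, by linarith⟩
    have hcube : ∀ i, u i ∈ Icc (0 : ℝ) 1 := fun i => by
      refine ⟨(sq_nonneg _).trans (hu i trivial).1, (hu i trivial).2.trans ?_⟩
      have h1 := center_le (i₀ := i₀) h.s_sq_le i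
      rw [frameCenter] at h1
      have h2 : node i₀ s i ≤ 3 / 4 := by nlinarith only [h1]
      exact pow_le_one₀ (by have := hnode i; positivity) (by linarith)
    refine ⟨h.mem u hcube, (h.rho_le u hcube).trans (le_trans ?_ hτd)⟩
    gcongr
    calc ∑ i, |√(u i) - node i₀ s i| ≤ ∑ _i : Fin d, τ := Finset.sum_le_sum fun i _ => hsq i
      _ = d * τ := by simp
  have hprod : K⁻¹ ^ d * K⁻¹ * (t ^ d * (√(bdDist Ω ξ) + t)) ≤
      ∏ i, ((node i₀ s i + τ) ^ 2 - node i₀ s i ^ 2) := by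
    have e : ∏ i : Fin d, (τ * if i = i₀ then K⁻¹ * (√(bdDist Ω ξ) + t) else 1) =
        K⁻¹ ^ d * K⁻¹ * (t ^ d * (√(bdDist Ω ξ) + t)) := by
      rw [Finset.prod_mul_distrib]; simp [hτ]; ring_nf
    rw [← e]
    refine Finset.prod_le_prod (fun i _ => by split_ifs <;> positivity) fun i _ => ?_
    have e1 : (node i₀ s i + τ) ^ 2 - node i₀ s i ^ 2 = τ * (2 * node i₀ s i + τ) := by ring
    rw [e1]
    refine mul_le_mul_of_nonneg_left ?_ hτ0.le
    split_ifs with hi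
    · subst hi
      have e2 : node i s i = s := by simp [node]
      have hs := h.s_nonneg
      have h1 := h.le_s
      have h2 : C * s ≤ K * s := by
        refine mul_le_mul_of_nonneg_right ?_ hs
        rw [hK]
        have : 1 ≤ 4 * T * d := by nlinarith only [hT, hd1]
        exact le_mul_of_one_le_left hC0.le this
      rw [e2, inv_mul_le_iff₀ hK0]
      nlinarith only [h1, h2, hτK, mul_nonneg hK0.le hs]
    · have := half_le_node_of_ne (s := s) hi
      linarith
  rw [volume_preimage_frameMap z₀ b i₀ h.lam_pos (measurableSet_Uball hΩ ξ t), mul_assoc (C⁻¹ ^ d),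
    ENNReal.ofReal_mul (by positivity)]
  refine mul_le_mul' (ENNReal.ofReal_le_ofReal (pow_le_pow_left₀ (by positivity) ?_ d)) ?_
  · exact inv_le_of_inv_le₀ h.lam_pos h.inv_lam_le
  refine le_trans ?_ (measure_mono hsub)
  rw [volume_pi_pi]
  simp only [Real.volume_Icc]
  rw [← ENNReal.ofReal_prod_of_nonneg fun i _ => by
    have := hnode i
    have : node i₀ s i ^ 2 ≤ (node i₀ s i + τ) ^ 2 := by gcongr; linarith
    linarith]
  exact ENNReal.ofReal_le_ofReal hprod

theorem exists_volume_Uball_le (hC : 1 ≤ C) (hΩ : IsCompact Ω)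
    (hfr : ∀ ξ ∈ Ω, ∃ z₀ b i₀ lam s, IsFrame Ω C ξ z₀ b i₀ lam s) :
    ∃ V : ℝ, 0 < V ∧ ∀ ξ ∈ Ω, ∀ t : ℝ, 0 < t →
      volume (Uball Ω ξ t) ≤ ENNReal.ofReal (V * (t ^ d * (√(bdDist Ω ξ) + t))) := by
  have hC0 : 0 < C := by linarith
  refine ⟨C ^ d * ((4 * C) ^ d * C) + (volume Ω).toReal * C ^ (d + 1), by positivity,
    fun ξ hξ t ht => ?_⟩
  have hδ := Real.sqrt_nonneg (bdDist Ω ξ)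
  rcases le_or_gt t C⁻¹ with h | h
  · obtain ⟨z₀, b, i₀, lam, s, hf⟩ := hfr ξ hξ
    refine (hf.volume_Uball_le hC hΩ.measurableSet ht h).trans (ENNReal.ofReal_le_ofReal ?_)
    gcongr
    exact le_add_of_nonneg_right (by positivity)
  · refine (measure_mono (sep_subset _ _)).trans ?_
    refine (ENNReal.ofReal_toReal hΩ.measure_lt_top.ne).ge.trans (ENNReal.ofReal_le_ofReal ?_)
    have h1 : 1 ≤ C ^ (d + 1) * (t ^ d * (√(bdDist Ω ξ) + t)) := by
      calc (1 : ℝ) = C ^ (d + 1) * (C⁻¹ ^ d * (0 + C⁻¹)) := by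
            rw [zero_add, ← pow_succ, ← mul_pow, mul_inv_cancel₀ hC0.ne', one_pow]
        _ ≤ _ := by gcongr
    calc (volume Ω).toReal = (volume Ω).toReal * 1 := (mul_one _).symm
      _ ≤ (volume Ω).toReal * (C ^ (d + 1) * (t ^ d * (√(bdDist Ω ξ) + t))) := by gcongr
      _ = (volume Ω).toReal * C ^ (d + 1) * (t ^ d * (√(bdDist Ω ξ) + t)) := by ring
      _ ≤ _ := mul_le_mul_of_nonneg_right (le_add_of_nonneg_left (by positivity)) (by positivity)

theorem exists_le_volume_Uball (hd : 0 < d) (hC : 1 ≤ C) (hΩ : MeasurableSet Ω)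
    (hfr : ∀ ξ ∈ Ω, ∃ z₀ b i₀ lam s, IsFrame Ω C ξ z₀ b i₀ lam s) {T : ℝ} (hT : 1 ≤ T) :
    ∃ v : ℝ, 0 < v ∧ ∀ ξ ∈ Ω, ∀ t : ℝ, 0 < t → t ≤ T →
      ENNReal.ofReal (v * (t ^ d * (√(bdDist Ω ξ) + t))) ≤ volume (Uball Ω ξ t) := by
  have hC0 : 0 < C := by linarith
  refine ⟨(C⁻¹) ^ d * ((4 * T * d * C)⁻¹ ^ d * (4 * T * d * C)⁻¹), by positivity,
    fun ξ hξ t ht htT => ?_⟩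
  obtain ⟨z₀, b, i₀, lam, s, hf⟩ := hfr ξ hξ
  exact hf.le_volume_Uball hd hC hΩ ht htT hT

end Volume

theorem lintegral_inv_one_add_pow_le {X : Type*} [MeasurableSpace X] {μ : Measure X} {a : X → ℝ}
    (ham : Measurable a) (ha : ∀ x, 0 ≤ a x) (m : ℕ) {D : ℝ} (hD : 0 ≤ D)
    (h : ∀ k : ℕ, μ {x | a x ≤ 2 ^ k} ≤ ENNReal.ofReal (D * (2 ^ k) ^ m)) :
    ∫⁻ x, ENNReal.ofReal (((1 + a x) ^ (m + 1))⁻¹) ∂μ ≤ ENNReal.ofReal (2 ^ (m + 2) * D) := by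
  set c : ℕ → ℝ≥0∞ := fun k => ENNReal.ofReal ((2 / 2 ^ k) ^ (m + 1)) with hc
  have hS : ∀ k : ℕ, MeasurableSet {x | a x ≤ 2 ^ k} := fun k =>
    measurableSet_le ham measurable_const
  have hpt : ∀ x, ENNReal.ofReal (((1 + a x) ^ (m + 1))⁻¹) ≤
      ∑' k, {x | a x ≤ 2 ^ k}.indicator (fun _ => c k) x := fun x => by
    have hex : ∃ k : ℕ, a x ≤ 2 ^ k := by
      obtain ⟨k, hk⟩ := pow_unbounded_of_one_lt (a x) (one_lt_two)
      exact ⟨k, hk.le⟩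
    obtain ⟨k, hk, hk2⟩ : ∃ k : ℕ, a x ≤ 2 ^ k ∧ (2 : ℝ) ^ k ≤ 2 * (1 + a x) := by
      classical
      refine ⟨Nat.find hex, Nat.find_spec hex, ?_⟩
      rcases Nat.eq_zero_or_pos (Nat.find hex) with h0 | h0
      · rw [h0, pow_zero]; linarith [ha x]
      · have h1 := Nat.find_min hex (Nat.sub_lt h0 one_pos)
        have h2 : (2 : ℝ) ^ Nat.find hex = 2 * 2 ^ (Nat.find hex - 1) := by
          rw [← pow_succ', Nat.sub_add_cancel h0]
        rw [h2]; push Not at h1; linarith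
    refine le_trans ?_ (ENNReal.le_tsum k)
    rw [indicator_of_mem (show x ∈ {x | a x ≤ 2 ^ k} from hk), hc]
    refine ENNReal.ofReal_le_ofReal ?_
    have h1 := ha x
    rw [← inv_pow]
    refine pow_le_pow_left₀ (by positivity) ?_ _
    rw [inv_le_comm₀ (by positivity) (by positivity), inv_div, div_le_iff₀ two_pos]
    linarith
  calc _ ≤ ∫⁻ x, ∑' k, {x | a x ≤ 2 ^ k}.indicator (fun _ => c k) x ∂μ := lintegral_mono hpt
    _ = ∑' k, ∫⁻ x, {x | a x ≤ 2 ^ k}.indicator (fun _ => c k) x ∂μ :=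
        lintegral_tsum fun k => (measurable_const.indicator (hS k)).aemeasurable
    _ = ∑' k, c k * μ {x | a x ≤ 2 ^ k} := by
        refine tsum_congr fun k => ?_
        rw [lintegral_indicator_const (hS k)]
    _ ≤ ∑' k : ℕ, ENNReal.ofReal (2 ^ (m + 1) * D * (1 / 2) ^ k) := by
        refine ENNReal.tsum_le_tsum fun k => ?_
        refine (mul_le_mul_right (h k) _).trans_eq ?_
        rw [hc, ← ENNReal.ofReal_mul (by positivity)]
        congr 1
        rw [div_pow, one_div, inv_pow, pow_succ ((2 : ℝ) ^ k)]
        field_simp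
    _ = _ := by
        rw [← ENNReal.ofReal_tsum_of_nonneg (fun k => by positivity)
          (summable_geometric_two.mul_left _), tsum_mul_left, tsum_geometric_two]
        congr 1; ring

section KernelIntegral

variable {d : ℕ} {Ω : Set (EuclideanSpace ℝ (Fin d))} {C : ℝ}

theorem lintegral_bdKernel_le {n : ℕ} (hn : 0 < n) {c : EuclideanSpace ℝ (Fin d)}
    {μ : Measure (EuclideanSpace ℝ (Fin d))} {V : ℝ} (hV : 0 ≤ V)
    (h : ∀ k : ℕ, μ {x | rhoMetric Ω c x ≤ 2 ^ k / n} ≤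
      ENNReal.ofReal (V * ((2 ^ k / n) ^ d * (√(bdDist Ω c) + 2 ^ k / n)))) :
    ∫⁻ x, ENNReal.ofReal (bdKernel Ω n (d + 2) c x) ∂μ ≤ ENNReal.ofReal (2 ^ (d + 3) * V) := by
  have hn' : (0 : ℝ) < n := by exact_mod_cast hn
  have hδ := Real.sqrt_nonneg (bdDist Ω c)
  have hρ := (measurable_rhoMetric Ω c).measurable
  have hmain := lintegral_inv_one_add_pow_le (μ := μ) (a := fun x => n * rhoMetric Ω c x)
    (by fun_prop) (fun x => mul_nonneg hn'.le rhoMetric_nonneg) (d + 1)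
    (D := V * ((√(bdDist Ω c) + 1 / n) / n ^ d)) (by positivity) (fun k => by
      have e : {x | (n : ℝ) * rhoMetric Ω c x ≤ 2 ^ k} = {x | rhoMetric Ω c x ≤ 2 ^ k / n} := by
        ext x
        rw [mem_ofPred_eq, mem_ofPred_eq, le_div_iff₀ hn', mul_comm]
      rw [e]
      refine (h k).trans (ENNReal.ofReal_le_ofReal ?_)
      have h1 : (1 : ℝ) ≤ 2 ^ k := one_le_pow₀ one_le_two
      calc V * ((2 ^ k / n) ^ d * (√(bdDist Ω c) + 2 ^ k / n))
          ≤ V * ((2 ^ k / n) ^ d * (2 ^ k * √(bdDist Ω c) + 2 ^ k / n)) := by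
            gcongr; exact le_mul_of_one_le_left hδ h1
        _ = _ := by rw [div_pow, pow_succ ((2 : ℝ) ^ k)]; field_simp)
  simp only [bdKernel]
  simp_rw [ENNReal.ofReal_mul (show 0 ≤ (n : ℝ) ^ d / (√(bdDist Ω c) + 1 / n) by positivity)]
  rw [lintegral_const_mul _ (by fun_prop)]
  refine (mul_le_mul_right hmain _).trans_eq ?_
  rw [← ENNReal.ofReal_mul (by positivity)]
  congr 1
  field_simp

theorem sum_volume_Uball_le (hΩ : MeasurableSet Ω) {Λ : Finset (EuclideanSpace ℝ (Fin d))}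
    {t r : ℝ} (ht : 0 < t) (hsep : ∀ ω ∈ Λ, ∀ ω' ∈ Λ, ω ≠ ω' → t ≤ rhoMetric Ω ω ω')
    {z : EuclideanSpace ℝ (Fin d)} (hz : ∀ ω ∈ Λ, rhoMetric Ω z ω ≤ r) :
    ∑ ω ∈ Λ, volume (Uball Ω ω (t / 3)) ≤ volume (Uball Ω z (r + t)) := by
  rw [← measure_biUnion_finset _ fun ω _ => measurableSet_Uball hΩ ω _]
  · refine measure_mono (iUnion₂_subset fun ω hω x hx => ⟨hx.1, ?_⟩)
    have h1 := rhoMetric_triangle (Ω := Ω) (x := z) (y := ω) (z := x)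
    have h2 := hz ω hω
    have h3 := hx.2
    linarith
  · intro ω hω ω' hω' hne
    refine Set.disjoint_left.mpr fun x hx hx' => ?_
    have h1 := hsep ω hω ω' hω' hne
    have h2 := rhoMetric_triangle (Ω := Ω) (x := ω) (y := x) (z := ω')
    have h3 := hx.2
    have h4 := hx'.2
    rw [rhoMetric_comm] at h4
    linarith

theorem exists_lintegral_sum_bdKernel_le (hd : 0 < d) (hC : 1 ≤ C) (hΩ : IsCompact Ω)
    (hfr : ∀ ξ ∈ Ω, ∃ z₀ b i₀ lam s, IsFrame Ω C ξ z₀ b i₀ lam s) {ℓ : ℝ} (hℓ : 1 ≤ ℓ) :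
    ∃ B : ℝ, 0 < B ∧ ∀ n : ℕ, 0 < n →
      (∀ ξ ∈ Ω, ∫⁻ z in Ω, ENNReal.ofReal (bdKernel Ω n (d + 3) ξ z) ≤ ENNReal.ofReal B) ∧
      ∀ ε : ℝ, 0 < ε → ε < ℓ → ∀ Λ : Finset (EuclideanSpace ℝ (Fin d)),
        (↑Λ : Set (EuclideanSpace ℝ (Fin d))) ⊆ Ω →
        (∀ ω ∈ Λ, ∀ ω' ∈ Λ, ω ≠ ω' → ε / n ≤ rhoMetric Ω ω ω') → ∀ z ∈ Ω,
        ∑ ξ ∈ Λ, volume (Uball Ω ξ (ε / n)) * ENNReal.ofReal (bdKernel Ω n (d + 3) ξ z) ≤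
          ENNReal.ofReal B := by
  obtain ⟨V, hV, hVle⟩ := exists_volume_Uball_le hC hΩ hfr
  obtain ⟨v, hv, hvle⟩ := exists_le_volume_Uball hd hC hΩ.measurableSet hfr hℓ
  have hΩm := hΩ.measurableSet
  set D := 3 ^ (d + 1) * V / v with hD
  have hD0 : 0 < D := by positivity
  set V' := D * (V * ((1 + ℓ) ^ d * (1 + ℓ))) with hV'
  have hV'0 : 0 < V' := by positivity
  refine ⟨2 ^ (d + 3) * V + 2 ^ (d + 3) * V', by positivity, fun n hn => ⟨fun ξ hξ => ?_, ?_⟩⟩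
  · have hn' : (0 : ℝ) < n := by exact_mod_cast hn
    calc _ ≤ ∫⁻ z in Ω, ENNReal.ofReal (bdKernel Ω n (d + 2) ξ z) :=
          lintegral_mono fun z => ENNReal.ofReal_le_ofReal bdKernel_succ_le
      _ ≤ ENNReal.ofReal (2 ^ (d + 3) * V) := by
          refine lintegral_bdKernel_le hn hV.le fun k => ?_
          rw [Measure.restrict_apply
            (measurableSet_le (measurable_rhoMetric Ω ξ).measurable measurable_const), inter_comm]
          exact hVle ξ hξ _ (by positivity)
      _ ≤ _ := ENNReal.ofReal_le_ofReal (le_add_of_nonneg_right (by positivity))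
  · intro ε hε hεℓ Λ hΛ hsep z hz
    have hn' : (0 : ℝ) < n := by exact_mod_cast hn
    have hn1 : (1 : ℝ) ≤ n := by exact_mod_cast hn
    have ht : 0 < ε / n := by positivity
    have htℓ : ε / n ≤ ℓ := (div_le_self hε.le hn1).trans hεℓ.le
    have hdoub : ∀ ξ ∈ Λ, volume (Uball Ω ξ (ε / n)) ≤
        ENNReal.ofReal D * volume (Uball Ω ξ (ε / n / 3)) := fun ξ hξ => by
      have h1 := hVle ξ (hΛ hξ) _ ht
      have h2 := hvle ξ (hΛ hξ) (ε / n / 3) (by positivity) (by linarith)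
      refine h1.trans (le_trans ?_ (mul_le_mul_right h2 _))
      rw [← ENNReal.ofReal_mul hD0.le]
      refine ENNReal.ofReal_le_ofReal ?_
      have hδ := Real.sqrt_nonneg (bdDist Ω ξ)
      calc V * ((ε / n) ^ d * (√(bdDist Ω ξ) + ε / n))
          ≤ V * ((ε / n) ^ d * (3 * √(bdDist Ω ξ) + ε / n)) := by gcongr; linarith
        _ = D * (v * ((ε / n / 3) ^ d * (√(bdDist Ω ξ) + ε / n / 3))) := by
            rw [hD, div_pow _ (3 : ℝ), pow_succ (3 : ℝ)]
            field_simp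
    set μ : Measure (EuclideanSpace ℝ (Fin d)) :=
      ∑ ξ ∈ Λ, volume (Uball Ω ξ (ε / n)) • Measure.dirac ξ with hμ
    have hint : ∀ F : EuclideanSpace ℝ (Fin d) → ℝ≥0∞, Measurable F →
        ∫⁻ x, F x ∂μ = ∑ ξ ∈ Λ, volume (Uball Ω ξ (ε / n)) * F ξ := fun F hF => by
      rw [hμ, lintegral_finsetSum_measure]
      refine Finset.sum_congr rfl fun ξ _ => ?_
      rw [lintegral_smul_measure, lintegral_dirac' _ hF, smul_eq_mul]
    have hk := continuous_bdKernel Ω n (d + 2) z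
    calc _ ≤ ∑ ξ ∈ Λ, volume (Uball Ω ξ (ε / n)) * ENNReal.ofReal (bdKernel Ω n (d + 2) z ξ) :=
          Finset.sum_le_sum fun ξ _ =>
            mul_le_mul_right (ENNReal.ofReal_le_ofReal (bdKernel_succ_le_swap hn)) _
      _ = ∫⁻ x, ENNReal.ofReal (bdKernel Ω n (d + 2) z x) ∂μ := (hint _ (by fun_prop)).symm
      _ ≤ ENNReal.ofReal (2 ^ (d + 3) * V') := by
          refine lintegral_bdKernel_le hn hV'0.le fun k => ?_
          classical
          have hm : MeasurableSet {x | rhoMetric Ω z x ≤ 2 ^ k / n} :=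
            measurableSet_le (measurable_rhoMetric Ω z).measurable measurable_const
          have h1 : (1 : ℝ) ≤ 2 ^ k := one_le_pow₀ one_le_two
          rw [← lintegral_indicator_one hm, hint _ (measurable_one.indicator hm)]
          have hδ := Real.sqrt_nonneg (bdDist Ω z)
          calc _ = ∑ ξ ∈ Λ.filter fun ξ => rhoMetric Ω z ξ ≤ 2 ^ k / n,
                volume (Uball Ω ξ (ε / n)) := by
                rw [Finset.sum_filter]
                refine Finset.sum_congr rfl fun ξ _ => ?_
                simp [indicator_apply]
            _ ≤ ∑ ξ ∈ Λ.filter fun ξ => rhoMetric Ω z ξ ≤ 2 ^ k / n,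
                ENNReal.ofReal D * volume (Uball Ω ξ (ε / n / 3)) :=
                Finset.sum_le_sum fun ξ hξ => hdoub ξ (Finset.mem_filter.mp hξ).1
            _ ≤ ENNReal.ofReal D * volume (Uball Ω z (2 ^ k / n + ε / n)) := by
                rw [← Finset.mul_sum]
                refine mul_le_mul_right (sum_volume_Uball_le hΩm ht (fun ω hω ω' hω' hne =>
                  hsep ω (Finset.mem_filter.mp hω).1 ω' (Finset.mem_filter.mp hω').1 hne)
                  fun ω hω => (Finset.mem_filter.mp hω).2) _
            _ ≤ ENNReal.ofReal D * ENNReal.ofReal (V * ((2 ^ k / n + ε / n) ^ d *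
                (√(bdDist Ω z) + (2 ^ k / n + ε / n)))) :=
                mul_le_mul_right (hVle z hz _ (by positivity)) _
            _ ≤ _ := by
                rw [← ENNReal.ofReal_mul hD0.le]
                refine ENNReal.ofReal_le_ofReal ?_
                have h2 : 2 ^ k / n + ε / n ≤ (1 + ℓ) * (2 ^ k / (n : ℝ)) := by
                  rw [← add_div, ← mul_div_assoc]
                  gcongr
                  nlinarith only [h1, hεℓ, hℓ]
                calc D * (V * ((2 ^ k / n + ε / n) ^ d * (√(bdDist Ω z) + (2 ^ k / n + ε / n))))
                    ≤ D * (V * (((1 + ℓ) * (2 ^ k / (n : ℝ))) ^ d *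
                      ((1 + ℓ) * √(bdDist Ω z) + (1 + ℓ) * (2 ^ k / (n : ℝ))))) := by
                      gcongr
                      exact le_mul_of_one_le_left hδ (by linarith)
                  _ = _ := by rw [hV', mul_pow]; ring
      _ ≤ _ := ENNReal.ofReal_le_ofReal (le_add_of_nonneg_left (by positivity))

end KernelIntegral

section Schur

variable {X : Type*} [MeasurableSpace X] {μ : Measure X} {k : X → ℝ≥0∞} {f : X → ℝ} {b : ℝ≥0∞}

theorem lintegral_enorm_mul_le_eLpNorm_withDensity (hk : Measurable k) (hf : Measurable f)
    (hb : ∫⁻ x, k x ∂μ ≤ b) {p : ℝ≥0∞} (hp : 1 ≤ p) :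
    ∫⁻ x, ‖f x‖ₑ * k x ∂μ ≤ eLpNorm f p (μ.withDensity k) * b ^ (1 - 1 / p.toReal) := by
  have h1 := eLpNorm_le_eLpNorm_mul_rpow_measure_univ (μ := μ.withDensity k) hp
    hf.aestronglyMeasurable
  rw [eLpNorm_one_eq_lintegral_enorm, lintegral_withDensity_eq_lintegral_mul _ hk hf.enorm,
    withDensity_apply _ MeasurableSet.univ, Measure.restrict_univ, ENNReal.toReal_one,
    div_one] at h1
  simp only [Pi.mul_apply, mul_comm (k _)] at h1
  refine h1.trans ?_
  gcongr
  rcases eq_or_ne p ∞ with rfl | hp'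
  · simp
  · have : 1 ≤ p.toReal := by simpa using ENNReal.toReal_mono hp' hp
    rw [sub_nonneg, div_le_one (by linarith)]
    exact this

theorem lintegral_enorm_mul_le_mul_eLpNorm_top (hk : Measurable k) (hf : Measurable f)
    (hb : ∫⁻ x, k x ∂μ ≤ b) : ∫⁻ x, ‖f x‖ₑ * k x ∂μ ≤ b * eLpNorm f ∞ μ := by
  refine (lintegral_enorm_mul_le_eLpNorm_withDensity hk hf hb le_top).trans ?_
  rw [ENNReal.toReal_top, div_zero, sub_zero, ENNReal.rpow_one, mul_comm, eLpNorm_exponent_top,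
    eLpNorm_exponent_top]
  gcongr
  exact withDensity_absolutelyContinuous μ k

theorem rpow_lintegral_enorm_mul_le (hk : Measurable k) (hf : Measurable f)
    (hb : ∫⁻ x, k x ∂μ ≤ b) {p : ℝ≥0∞} (hp : 1 ≤ p) (hp' : p ≠ ∞) :
    (∫⁻ x, ‖f x‖ₑ * k x ∂μ) ^ p.toReal ≤
      b ^ (p.toReal - 1) * ∫⁻ x, ‖f x‖ₑ ^ p.toReal * k x ∂μ := by
  have hp1 : 1 ≤ p.toReal := by simpa using ENNReal.toReal_mono hp' hp
  have h1 := ENNReal.rpow_le_rpow (lintegral_enorm_mul_le_eLpNorm_withDensity hk hf hb hp)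
    (zero_le_one.trans hp1)
  refine h1.trans_eq ?_
  rw [ENNReal.mul_rpow_of_nonneg _ _ (zero_le_one.trans hp1), ← ENNReal.rpow_mul,
    eLpNorm_eq_lintegral_rpow_enorm_toReal (zero_lt_one.trans_le hp).ne' hp', ← ENNReal.rpow_mul,
    lintegral_withDensity_eq_lintegral_mul _ hk (hf.enorm.pow_const _)]
  have e : (1 - 1 / p.toReal) * p.toReal = p.toReal - 1 := by field_simp
  rw [e, one_div_mul_cancel (by linarith), ENNReal.rpow_one, mul_comm]
  simp only [Pi.mul_apply, mul_comm (k _)]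

theorem sum_mul_rpow_lintegral_le {ι : Type*} {Λ : Finset ι} {k : ι → X → ℝ≥0∞} {v : ι → ℝ≥0∞}
    (hk : ∀ i, Measurable (k i)) (hf : Measurable f) (hb0 : b ≠ 0) (hb : b ≠ ∞)
    (hrow : ∀ i ∈ Λ, ∫⁻ x, k i x ∂μ ≤ b) (hcol : ∀ᵐ x ∂μ, ∑ i ∈ Λ, v i * k i x ≤ b)
    {p : ℝ≥0∞} (hp : 1 ≤ p) (hp' : p ≠ ∞) :
    (∑ i ∈ Λ, v i * (∫⁻ x, ‖f x‖ₑ * k i x ∂μ) ^ p.toReal) ^ (1 / p.toReal) ≤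
      b * eLpNorm f p μ := by
  have hp1 : 1 ≤ p.toReal := by simpa using ENNReal.toReal_mono hp' hp
  have hp0 : 0 ≤ p.toReal := zero_le_one.trans hp1
  have hsum : ∑ i ∈ Λ, v i * (∫⁻ x, ‖f x‖ₑ * k i x ∂μ) ^ p.toReal ≤
      b ^ p.toReal * ∫⁻ x, ‖f x‖ₑ ^ p.toReal ∂μ := by
    calc _ ≤ ∑ i ∈ Λ, v i * (b ^ (p.toReal - 1) * ∫⁻ x, ‖f x‖ₑ ^ p.toReal * k i x ∂μ) :=
          Finset.sum_le_sum fun i hi =>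
            mul_le_mul_right (rpow_lintegral_enorm_mul_le (hk i) hf (hrow i hi) hp hp') _
      _ = b ^ (p.toReal - 1) * ∫⁻ x, ‖f x‖ₑ ^ p.toReal * ∑ i ∈ Λ, v i * k i x ∂μ := by
          have e : ∀ x, ‖f x‖ₑ ^ p.toReal * ∑ i ∈ Λ, v i * k i x =
              ∑ i ∈ Λ, v i * (‖f x‖ₑ ^ p.toReal * k i x) := fun x => by
            rw [Finset.mul_sum]
            exact Finset.sum_congr rfl fun i _ => mul_left_comm _ _ _
          have hm : ∀ i, Measurable fun x => ‖f x‖ₑ ^ p.toReal * k i x := fun i =>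
            (hf.enorm.pow_const _).mul (hk i)
          simp_rw [e]
          rw [lintegral_finsetSum _ fun i _ => (hm i).const_mul _, Finset.mul_sum]
          refine Finset.sum_congr rfl fun i _ => ?_
          rw [lintegral_const_mul _ (hm i), mul_left_comm]
      _ ≤ b ^ (p.toReal - 1) * ∫⁻ x, ‖f x‖ₑ ^ p.toReal * b ∂μ := by
          refine mul_le_mul_right (lintegral_mono_ae ?_) _
          filter_upwards [hcol] with x hx
          gcongr
      _ = _ := by
          rw [lintegral_mul_const _ (hf.enorm.pow_const _), mul_comm (lintegral _ _), ← mul_assoc]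
          congr 1
          nth_rw 2 [← ENNReal.rpow_one b]
          rw [← ENNReal.rpow_add _ _ hb0 hb, sub_add_cancel]
  refine (ENNReal.rpow_le_rpow hsum (by positivity)).trans_eq ?_
  rw [ENNReal.mul_rpow_of_nonneg _ _ (by positivity), ← ENNReal.rpow_mul,
    mul_one_div_cancel (by linarith), ENNReal.rpow_one,
    eLpNorm_eq_lintegral_rpow_enorm_toReal (zero_lt_one.trans_le hp).ne' hp']

end Schur

/-- **Theorem 7.1** (oscillation estimate for `(ε/n)`-separated sets on compact
`C²`-domains). -/
theorem oscillation_estimate {d : ℕ} (hd : 2 ≤ d)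
    (Ω : Set (EuclideanSpace ℝ (Fin d)))
    (ν : EuclideanSpace ℝ (Fin d) → EuclideanSpace ℝ (Fin d))
    (hΩ : IsCompactC2Domain Ω ν)
    (ℓ : ℝ) (hℓ : 1 ≤ ℓ) :
    ∃ C : ℝ, 0 < C ∧
      ∀ (n : ℕ), 0 < n → ∀ ε : ℝ, 0 < ε → ε < ℓ →
      ∀ Λ : Finset (EuclideanSpace ℝ (Fin d)),
        (↑Λ : Set (EuclideanSpace ℝ (Fin d))) ⊆ Ω →
        (∀ ω ∈ Λ, ∀ ω' ∈ Λ, ω ≠ ω' → ε / n ≤ rhoMetric Ω ω ω') →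
        ∀ p : ℝ≥0∞, 1 ≤ p →
        ∀ f : EuclideanSpace ℝ (Fin d) → ℝ, IsPolyDeg n f →
          (p ≠ ∞ →
            (∑ ξ ∈ Λ, volume (Uball Ω ξ (ε / n)) *
                ENNReal.ofReal (osc f (Uball Ω ξ (ℓ * ε / n))) ^ p.toReal) ^ (1 / p.toReal)
              ≤ ENNReal.ofReal (C * ε) * eLpNorm f p (volume.restrict Ω)) ∧
          (p = ∞ →
            (⨆ ξ ∈ Λ, ENNReal.ofReal (osc f (Uball Ω ξ (ℓ * ε / n))))
              ≤ ENNReal.ofReal (C * ε) * eLpNorm f p (volume.restrict Ω)) := by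
  have hd0 : 0 < d := by omega
  obtain ⟨κ, hκ⟩ := hΩ.exists_rollingBall
  obtain ⟨C, hC, hfr⟩ := hκ.exists_isFrame hd0
  have hΩc := hκ.isCompact
  obtain ⟨A, hA, hosc⟩ := exists_osc_le_kernelAverage hC hΩc.measurableSet hfr (d + 3) hℓ
  obtain ⟨B, hB, hker⟩ := exists_lintegral_sum_bdKernel_le hd0 hC hΩc hfr hℓ
  refine ⟨A * B, by positivity, fun n hn ε hε hεℓ Λ hΛ hsep p hp f hf => ?_⟩
  have hb0 : ENNReal.ofReal B ≠ 0 := by simpa using hB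
  have hfm := hf.continuous.measurable
  have hkm : ∀ ξ, Measurable fun z => ENNReal.ofReal (bdKernel Ω n (d + 3) ξ z) := fun ξ =>
    (continuous_bdKernel Ω n (d + 3) ξ).measurable.ennreal_ofReal
  have hconst : ENNReal.ofReal (A * B * ε) = ENNReal.ofReal (A * ε) * ENNReal.ofReal B := by
    rw [← ENNReal.ofReal_mul (by positivity)]; congr 1; ring
  rw [hconst, mul_assoc]
  refine ⟨fun hp' => ?_, fun hp' => ?_⟩
  · have hp1 : 1 ≤ p.toReal := by simpa using ENNReal.toReal_mono hp' hp
    have hschur := sum_mul_rpow_lintegral_le (μ := volume.restrict Ω) (Λ := Λ)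
      (v := fun ξ => volume (Uball Ω ξ (ε / n))) hkm hfm hb0 ENNReal.ofReal_ne_top
      (fun ξ hξ => (hker n hn).1 ξ (hΛ hξ))
      (ae_restrict_of_forall_mem hΩc.measurableSet ((hker n hn).2 ε hε hεℓ Λ hΛ hsep)) hp hp'
    refine le_trans ?_ (mul_le_mul_right hschur _)
    calc _ ≤ (ENNReal.ofReal (A * ε) ^ p.toReal * ∑ ξ ∈ Λ, volume (Uball Ω ξ (ε / n)) *
          kernelAverage Ω n (d + 3) f ξ ^ p.toReal) ^ (1 / p.toReal) := by
          refine ENNReal.rpow_le_rpow ?_ (by positivity)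
          rw [Finset.mul_sum]
          refine Finset.sum_le_sum fun ξ hξ => ?_
          rw [mul_left_comm, ← ENNReal.mul_rpow_of_nonneg _ _ (by positivity)]
          gcongr
          exact hosc n hn ε hε hεℓ f hf ξ (hΛ hξ)
      _ = _ := by
          rw [ENNReal.mul_rpow_of_nonneg _ _ (by positivity), ← ENNReal.rpow_mul,
            mul_one_div_cancel (by linarith), ENNReal.rpow_one]
          rfl
  · subst hp'
    refine iSup₂_le fun ξ hξ => (hosc n hn ε hε hεℓ f hf ξ (hΛ hξ)).trans ?_
    gcongr
    exact lintegral_enorm_mul_le_mul_eLpNorm_top (hkm ξ) hfm ((hker n hn).1 ξ (hΛ hξ))
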